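/- arXiv:1707.06536 — 3 statements merged into one kernel-verified Lean document; each statement's English description precedes it below -/
import Mathlib

section
/- Let R be a Noetherian ring, 𝔞, 𝔟, 𝔠 ideals of R, and M a finitely generated R-module with c := cd(𝔞, M) finite. If H^c_𝔞(M/𝔟M) ≅ H^c_𝔞(M) and H^c_𝔞(M/𝔠M) ≅ H^c_𝔞(M), then H^c_𝔞(M/(𝔟M + 𝔠M)) ≅ H^c_𝔞(M). -/
open CategoryTheory

/-- `HasCD a M c` : the cohomological dimension of `M` with respect to `a` is `c`,
i.e. `H^c_a(M) ≠ 0` and `H^i_a(M) = 0` for all `i > c`. -/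
def HasCD {R : Type} [CommRing R] (a : Ideal R) (M : ModuleCat R) (c : ℕ) : Prop :=
  Nontrivial ((localCohomology a c).obj M) ∧
    ∀ i, c < i → Subsingleton ((localCohomology a i).obj M)

/-- The attached primes of an `R`-module `A`: primes of the form `Ann_R(A/B)`. -/
def attachedPrimes (R : Type) [CommRing R] (A : Type) [AddCommGroup A] [Module R A] :
    Set (Ideal R) :=
  {p | p.IsPrime ∧ ∃ B : Submodule R A, p = Module.annihilator R (A ⧸ B)}

open Opposite

namespace LCAux

variable {R : Type} [CommRing R]

/-- The contravariant hom functor, as a covariant functor to the opposite category. -/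
noncomputable abbrev FF (N : ModuleCat.{0} R) : ModuleCat.{0} R ⥤ (ModuleCat.{0} R)ᵒᵖ :=
  ((linearYoneda R (ModuleCat.{0} R)).obj N).rightOp

/-- the complex `Hom(P, N)` in the opposite category -/
noncomputable abbrev KK {L : ModuleCat.{0} R} (P : ProjectiveResolution L) (N : ModuleCat.{0} R) :
    ChainComplex (ModuleCat.{0} R)ᵒᵖ ℕ :=
  ((FF N).mapHomologicalComplex _).obj P.complex

/-- old Ext -/
noncomputable abbrev OE (n : ℕ) (L N : ModuleCat.{0} R) : ModuleCat.{0} R :=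
  ((Ext R (ModuleCat.{0} R) n).obj (op L)).obj N

noncomputable def oeIso (n : ℕ) {L : ModuleCat.{0} R} (P : ProjectiveResolution L)
    (N : ModuleCat.{0} R) : OE n L N ≅ unop ((KK P N).homology n) :=
  (P.isoLeftDerivedObj (FF N) n).unop.symm

/-- `f` represents `ξ`. -/
def Rep (n : ℕ) {L : ModuleCat.{0} R} (P : ProjectiveResolution L)
    {N : ModuleCat.{0} R} (ξ : OE n L N) (f : P.complex.X n ⟶ N) : Prop :=
  ∃ z : (unop ((KK P N).opcycles n) : ModuleCat.{0} R),
    ((KK P N).homologyι n).unop.hom z = (oeIso n P N).hom.hom ξ ∧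
    ((KK P N).pOpcycles n).unop.hom z = f

lemma oe_map_left (n : ℕ) {L L' : ModuleCat.{0} R} (P : ProjectiveResolution L)
    (P' : ProjectiveResolution L') (N : ModuleCat.{0} R) (u : L' ⟶ L)
    (φ : ProjectiveResolution.Hom P' P u) :
    ((Ext R (ModuleCat.{0} R) n).map u.op).app N ≫ (oeIso n P' N).hom =
      (oeIso n P N).hom ≫ ((HomologicalComplex.homologyFunctor _ _ n).map
        (((FF N).mapHomologicalComplex _).map φ.hom)).unop := by
  have := P'.isoLeftDerivedObj_inv_naturality u P φ.hom φ.hom_f_zero_comp_π_f_zero (FF N) n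
  exact congrArg Quiver.Hom.unop this

lemma oe_map_right (n : ℕ) {L : ModuleCat.{0} R} (P : ProjectiveResolution L)
    {N N' : ModuleCat.{0} R} (g : N ⟶ N') :
    ((Ext R (ModuleCat.{0} R) n).obj (op L)).map g ≫ (oeIso n P N').hom =
      (oeIso n P N).hom ≫ ((HomologicalComplex.homologyFunctor _ _ n).map
        ((NatTrans.mapHomologicalComplex
          (NatTrans.rightOp ((linearYoneda R (ModuleCat.{0} R)).map g)) _).app P.complex)).unop := by
  have := P.leftDerived_app_eq (NatTrans.rightOp ((linearYoneda R (ModuleCat.{0} R)).map g)) n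
  have h2 : (P.isoLeftDerivedObj (FF N') n).inv ≫ (NatTrans.leftDerived
      (NatTrans.rightOp ((linearYoneda R (ModuleCat.{0} R)).map g)) n).app L =
      (HomologicalComplex.homologyFunctor _ _ n).map
        ((NatTrans.mapHomologicalComplex
          (NatTrans.rightOp ((linearYoneda R (ModuleCat.{0} R)).map g)) _).app P.complex) ≫
      (P.isoLeftDerivedObj (FF N) n).inv := by
    rw [this]; exact Iso.inv_hom_id_assoc _ _
  exact congrArg Quiver.Hom.unop h2

lemma rep_surj (n : ℕ) {L : ModuleCat.{0} R} (P : ProjectiveResolution L)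
    {N : ModuleCat.{0} R} (ξ : OE n L N) : ∃ f, Rep n P ξ f := by
  obtain ⟨z, hz⟩ := (ModuleCat.epi_iff_surjective ((KK P N).homologyι n).unop).1 inferInstance
    ((oeIso n P N).hom.hom ξ)
  exact ⟨_, z, hz, rfl⟩

lemma rep_cocycle (n : ℕ) {L : ModuleCat.{0} R} (P : ProjectiveResolution L)
    {N : ModuleCat.{0} R} (ξ : OE n L N) (f : P.complex.X n ⟶ N) (h : Rep n P ξ f) :
    P.complex.d (n+1) n ≫ f = 0 := by
  obtain ⟨z, -, rfl⟩ := h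
  have := congrArg Quiver.Hom.unop ((KK P N).d_pOpcycles (n+1) n)
  exact congrArg (fun q => q.hom z) this

lemma rep_smul_add (n : ℕ) {L : ModuleCat.{0} R} (P : ProjectiveResolution L)
    {N : ModuleCat.{0} R} (r : R) (ξ ξ' : OE n L N) (f f' : P.complex.X n ⟶ N)
    (h : Rep n P ξ f) (h' : Rep n P ξ' f') : Rep n P (r • ξ + ξ') (r • f + f') := by
  obtain ⟨z, hz, rfl⟩ := h
  obtain ⟨z', hz', rfl⟩ := h'
  refine ⟨r • z + z', ?_, ?_⟩
  · simp only [map_add, map_smul, hz, hz']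
  · simp only [map_add, map_smul]
    rfl

lemma rep_left (n : ℕ) {L L' : ModuleCat.{0} R} (P : ProjectiveResolution L)
    (P' : ProjectiveResolution L') (N : ModuleCat.{0} R) (u : L' ⟶ L)
    (φ : ProjectiveResolution.Hom P' P u) (ξ : OE n L N) (f : P.complex.X n ⟶ N)
    (h : Rep n P ξ f) :
    Rep n P' ((((Ext R (ModuleCat.{0} R) n).map u.op).app N).hom ξ) (φ.hom.f n ≫ f) := by
  obtain ⟨z, hz, rfl⟩ := h
  let Φ := (((FF N).mapHomologicalComplex (ComplexShape.down ℕ)).map φ.hom)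
  refine ⟨(HomologicalComplex.opcyclesMap Φ n).unop.hom z, ?_, ?_⟩
  · have h1 := congrArg Quiver.Hom.unop (HomologicalComplex.homologyι_naturality Φ n)
    have h2 := congrArg (fun q => q.hom z) h1
    have h3 := congrArg (fun q => q.hom ξ) (oe_map_left n P P' N u φ)
    refine (h2.symm.trans ?_).trans h3.symm
    exact congrArg _ hz
  · have h1 := congrArg Quiver.Hom.unop (HomologicalComplex.p_opcyclesMap Φ n)
    exact congrArg (fun q => q.hom z) h1

lemma rep_right (n : ℕ) {L : ModuleCat.{0} R} (P : ProjectiveResolution L)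
    {N N' : ModuleCat.{0} R} (g : N ⟶ N') (ξ : OE n L N) (f : P.complex.X n ⟶ N)
    (h : Rep n P ξ f) :
    Rep n P ((((Ext R (ModuleCat.{0} R) n).obj (op L)).map g).hom ξ) (f ≫ g) := by
  obtain ⟨z, hz, rfl⟩ := h
  let Φ := ((NatTrans.mapHomologicalComplex
          (NatTrans.rightOp ((linearYoneda R (ModuleCat.{0} R)).map g))
            (ComplexShape.down ℕ)).app P.complex)
  refine ⟨(HomologicalComplex.opcyclesMap Φ n).unop.hom z, ?_, ?_⟩
  · have h1 := congrArg Quiver.Hom.unop (HomologicalComplex.homologyι_naturality Φ n)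
    have h2 := congrArg (fun q => q.hom z) h1
    have h3 := congrArg (fun q => q.hom ξ) (oe_map_right n P g)
    refine (h2.symm.trans ?_).trans h3.symm
    exact congrArg _ hz
  · have h1 := congrArg Quiver.Hom.unop (HomologicalComplex.p_opcyclesMap Φ n)
    exact congrArg (fun q => q.hom z) h1

lemma rep_exists (n : ℕ) {L : ModuleCat.{0} R} (P : ProjectiveResolution L)
    {N : ModuleCat.{0} R} (f : P.complex.X n ⟶ N)
    (hf : P.complex.d (n+1) n ≫ f = 0) : ∃ ξ, Rep n P ξ f := by
  have hex : (ShortComplex.mk ((KK P N).d (n+1) n) ((KK P N).pOpcycles n)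
    ((KK P N).d_pOpcycles (n+1) n)).Exact :=
    ShortComplex.exact_of_g_is_cokernel _ ((KK P N).opcyclesIsCokernel (n+1) n (by simp))
  have h2 := (ShortComplex.moduleCat_exact_iff _).1 hex.unop f hf
  obtain ⟨z, hz⟩ := h2
  exact ⟨(oeIso n P N).inv.hom (((KK P N).homologyι n).unop.hom z), z, by simp, hz⟩

lemma rep_zero (n : ℕ) {L : ModuleCat.{0} R} (P : ProjectiveResolution L)
    {N : ModuleCat.{0} R} (f : P.complex.X n ⟶ N) :
    Rep n P (0 : OE n L N) f ↔
      ∃ g : P.complex.X ((ComplexShape.down ℕ).next n) ⟶ N, P.complex.d n _ ≫ g = f := by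
  have hd := congrArg Quiver.Hom.unop ((KK P N).p_fromOpcycles n ((ComplexShape.down ℕ).next n))
  have hex : (ShortComplex.mk ((KK P N).homologyι n)
    ((KK P N).fromOpcycles n ((ComplexShape.down ℕ).next n)) (by simp)).Exact :=
    ShortComplex.exact_of_f_is_kernel _ ((KK P N).homologyIsKernel n _ rfl)
  constructor
  · rintro ⟨z, hz, rfl⟩
    obtain ⟨g, hg⟩ := (ShortComplex.moduleCat_exact_iff _).1 hex.unop z (by
      refine hz.trans (map_zero _))
    refine ⟨g, ?_⟩
    rw [← hg]
    exact (congrArg (fun q => q.hom g) hd).symm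
  · rintro ⟨g, rfl⟩
    refine ⟨((KK P N).fromOpcycles n ((ComplexShape.down ℕ).next n)).unop.hom g, ?_, ?_⟩
    · rw [map_zero]
      have := congrArg Quiver.Hom.unop
        ((KK P N).homologyι_comp_fromOpcycles n ((ComplexShape.down ℕ).next n))
      exact congrArg (fun q => q.hom g) this
    · exact (congrArg (fun q => q.hom g) hd)

lemma rep_unique (n : ℕ) {L : ModuleCat.{0} R} (P : ProjectiveResolution L)
    {N : ModuleCat.{0} R} (f : P.complex.X n ⟶ N) (ξ ξ' : OE n L N)
    (h : Rep n P ξ f) (h' : Rep n P ξ' f) : ξ = ξ' := by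
  obtain ⟨z, hz, hf⟩ := h
  obtain ⟨z', hz', hf'⟩ := h'
  have hi : Function.Injective ((KK P N).pOpcycles n).unop.hom :=
    (ModuleCat.mono_iff_injective ((KK P N).pOpcycles n).unop).1 inferInstance
  obtain rfl := hi (hf.trans hf'.symm)
  have hj : Function.Injective (oeIso n P N).hom.hom :=
    (ModuleCat.mono_iff_injective _).1 inferInstance
  exact hj (hz.symm.trans hz')

lemma extMk_eq_zero_iff' (n : ℕ) {L : ModuleCat.{0} R} (P : ProjectiveResolution L)
    {N : ModuleCat.{0} R} (f : P.complex.X n ⟶ N) (hf : P.complex.d (n+1) n ≫ f = 0) :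
    P.extMk f (n+1) rfl hf = 0 ↔
      ∃ g : P.complex.X ((ComplexShape.down ℕ).next n) ⟶ N, P.complex.d n _ ≫ g = f := by
  cases n with
  | succ n =>
    rw [show (ComplexShape.down ℕ).next (n+1) = n from by simp]
    exact P.extMk_eq_zero_iff f _ rfl hf n rfl
  | zero =>
    rw [P.complex.shape 0 _ (by simp)]
    simp only [Limits.zero_comp, exists_const]
    constructor
    · intro h
      simp only [← P.extEquivCohomologyClass.apply_eq_iff_eq,
        ProjectiveResolution.extEquivCohomologyClass_extMk,
        ProjectiveResolution.extEquivCohomologyClass_zero,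
        CochainComplex.HomComplex.CohomologyClass.mk_eq_zero_iff] at h
      rw [CochainComplex.HomComplex.Cocycle.toSingleMk_mem_coboundaries_iff _ _ _ _ _ 1
        (by simp)] at h
      obtain ⟨g, hg⟩ := h
      have h0 : P.cochainComplex.d (-((0:ℕ):ℤ)) 1 = 0 := 
        Limits.IsZero.eq_of_tgt (P.cochainComplex.isZero_of_isStrictlyLE 0 1) _ _
      rw [h0, Limits.zero_comp] at hg
      rw [← cancel_epi (P.cochainComplexXIso (-((0:ℕ):ℤ)) 0 rfl).hom, ← hg, Limits.comp_zero]
    · rintro rfl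
      simp

/-- comparison map from the old Ext to the new Ext -/
noncomputable def toNew (n : ℕ) (L N : ModuleCat.{0} R) (ξ : OE n L N) : Abelian.Ext L N n :=
  (projectiveResolution L).extMk (rep_surj n (projectiveResolution L) ξ).choose (n+1) rfl
    (rep_cocycle _ _ _ _ (rep_surj n (projectiveResolution L) ξ).choose_spec)

lemma toNew_eq (n : ℕ) {L N : ModuleCat.{0} R} (ξ : OE n L N)
    (f : (projectiveResolution L).complex.X n ⟶ N) (h : Rep n (projectiveResolution L) ξ f) :
    toNew n L N ξ = (projectiveResolution L).extMk f (n+1) rfl (rep_cocycle _ _ _ _ h) := by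
  have h' := (rep_surj n (projectiveResolution L) ξ).choose_spec
  rw [toNew, ← sub_eq_zero, ProjectiveResolution.sub_extMk, extMk_eq_zero_iff', ← rep_zero]
  have := rep_smul_add n _ (-1) ξ ξ f _ h h'
  simpa [sub_eq_neg_add] using this

lemma toNew_add (n : ℕ) {L N : ModuleCat.{0} R} (ξ ξ' : OE n L N) :
    toNew n L N (ξ + ξ') = toNew n L N ξ + toNew n L N ξ' := by
  obtain ⟨f, hf⟩ := rep_surj n (projectiveResolution L) ξ
  obtain ⟨f', hf'⟩ := rep_surj n (projectiveResolution L) ξ'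
  have h := rep_smul_add n _ 1 ξ ξ' f f' hf hf'
  simp only [one_smul] at h
  rw [toNew_eq n _ _ hf, toNew_eq n _ _ hf', toNew_eq n _ _ h, ProjectiveResolution.add_extMk]

lemma rep_zero_zero (n : ℕ) {L : ModuleCat.{0} R} (P : ProjectiveResolution L)
    {N : ModuleCat.{0} R} : Rep n P (0 : OE n L N) 0 := by
  rw [rep_zero]; exact ⟨0, by simp⟩

lemma toNew_right (n : ℕ) {L N N' : ModuleCat.{0} R} (g : N ⟶ N') (ξ : OE n L N) :
    toNew n L N' ((((Ext R (ModuleCat.{0} R) n).obj (op L)).map g).hom ξ) =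
      (toNew n L N ξ).comp (Abelian.Ext.mk₀ g) (add_zero n) := by
  obtain ⟨f, hf⟩ := rep_surj n (projectiveResolution L) ξ
  rw [toNew_eq n _ _ hf, toNew_eq n _ _ (rep_right n _ g ξ f hf),
    ProjectiveResolution.extMk_comp_mk₀]

lemma toNew_left (n : ℕ) {L L' N : ModuleCat.{0} R} (u : L' ⟶ L) (ξ : OE n L N) :
    toNew n L' N ((((Ext R (ModuleCat.{0} R) n).map u.op).app N).hom ξ) =
      (Abelian.Ext.mk₀ u).comp (toNew n L N ξ) (zero_add n) := by
  obtain ⟨f, hf⟩ := rep_surj n (projectiveResolution L) ξ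
  let φ : ProjectiveResolution.Hom (projectiveResolution L') (projectiveResolution L) u :=
    ⟨ProjectiveResolution.lift u _ _, ProjectiveResolution.lift_commutes_zero _ _ _⟩
  rw [toNew_eq n _ _ hf, toNew_eq n _ _ (rep_left n _ _ N u φ ξ f hf),
    ProjectiveResolution.mk₀_comp_extMk _ _ _ _ φ]

lemma toNew_smul (n : ℕ) {L N : ModuleCat.{0} R} (r : R) (ξ : OE n L N) :
    toNew n L N (r • ξ) =
      (toNew n L N ξ).comp (Abelian.Ext.mk₀ (r • 𝟙 N)) (add_zero n) := by
  obtain ⟨f, hf⟩ := rep_surj n (projectiveResolution L) ξ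
  have h := rep_smul_add n _ r ξ 0 f 0 hf (rep_zero_zero n _)
  simp only [add_zero] at h
  rw [toNew_eq n _ _ hf, toNew_eq n _ _ h, ProjectiveResolution.extMk_comp_mk₀]
  congr 1

lemma toNew_surj (n : ℕ) {L N : ModuleCat.{0} R} (η : Abelian.Ext L N n) :
    ∃ ξ, toNew n L N ξ = η := by
  obtain ⟨f, hf, rfl⟩ := (projectiveResolution L).extMk_surjective η (n+1) rfl
  obtain ⟨ξ, h⟩ := rep_exists n _ f hf
  exact ⟨ξ, toNew_eq n _ _ h⟩

lemma toNew_eq_zero (n : ℕ) {L N : ModuleCat.{0} R} (ξ : OE n L N) :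
    toNew n L N ξ = 0 ↔ ξ = 0 := by
  obtain ⟨f, hf⟩ := rep_surj n (projectiveResolution L) ξ
  rw [toNew_eq n _ _ hf, extMk_eq_zero_iff', ← rep_zero]
  constructor
  · intro h; exact rep_unique n _ f _ _ hf h
  · rintro rfl; exact hf

end LCAux


namespace LCAux

variable {R : Type} [CommRing R]

noncomputable def newEquiv (n : ℕ) (L N : ModuleCat.{0} R) : OE n L N ≃+ Abelian.Ext L N n :=
  AddEquiv.ofBijective (⟨⟨toNew n L N, (toNew_eq_zero n _).2 rfl⟩, toNew_add n⟩ :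
      OE n L N →+ Abelian.Ext L N n)
    ⟨(injective_iff_map_eq_zero _).2 fun ξ h => (toNew_eq_zero n ξ).1 h,
      fun η => toNew_surj n η⟩

abbrev QQ (I : Ideal R) : ModuleCat.{0} R := ModuleCat.of R (R ⧸ I)

def pi {I J : Ideal R} (h : I ≤ J) : QQ I ⟶ QQ J :=
  ModuleCat.ofHom (Submodule.mapQ I J LinearMap.id h)

/-- pull back of Ext classes -/
noncomputable abbrev pb {n : ℕ} {L L' N : ModuleCat.{0} R} (u : L' ⟶ L) (η : Abelian.Ext L N n) :
    Abelian.Ext L' N n := (Abelian.Ext.mk₀ u).comp η (zero_add n)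

/-- push forward of Ext classes -/
noncomputable abbrev pf {n : ℕ} {L N N' : ModuleCat.{0} R} (g : N ⟶ N') (η : Abelian.Ext L N n) :
    Abelian.Ext L N' n := η.comp (Abelian.Ext.mk₀ g) (add_zero n)

open localCohomology Limits

noncomputable def iota (a : Ideal R) (n t : ℕ) (N : ModuleCat.{0} R) :
    OE n (QQ (a ^ t)) N ⟶ (localCohomology a n).obj N :=
  (colimit.ι (diagram (idealPowersDiagram a) n) (op (op t))).app N

noncomputable def isCol (a : Ideal R) (n : ℕ) (N : ModuleCat.{0} R) :
    IsColimit (((evaluation _ _).obj N).mapCocone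
      (colimit.cocone (diagram (idealPowersDiagram a) n))) :=
  isColimitOfPreserves ((evaluation (ModuleCat.{0} R) (ModuleCat.{0} R)).obj N)
    (colimit.isColimit (diagram (idealPowersDiagram a) n))

instance : IsFiltered (ℕᵒᵖᵒᵖ) := isFiltered_op_of_isCofiltered _

/-- structure map into local cohomology -/
noncomputable def inl (a : Ideal R) (n t : ℕ) (N : ModuleCat.{0} R) :
    Abelian.Ext (QQ (a ^ t)) N n →+ (localCohomology a n).obj N :=
  (iota a n t N).hom.toAddMonoidHom.comp (newEquiv n _ N).symm.toAddMonoidHom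

lemma inl_toNew (a : Ideal R) (n t : ℕ) (N : ModuleCat.{0} R) (ξ : OE n (QQ (a ^ t)) N) :
    inl a n t N (toNew n _ N ξ) = (iota a n t N).hom ξ := by
  change (iota a n t N).hom ((newEquiv n _ N).symm ((newEquiv n _ N) ξ)) = _
  rw [AddEquiv.symm_apply_apply]

lemma inl_surj (a : Ideal R) (n : ℕ) (N : ModuleCat.{0} R) (h : (localCohomology a n).obj N) :
    ∃ t η, inl a n t N η = h := by
  obtain ⟨j, y, hy⟩ := Concrete.isColimit_exists_rep _ (isCol a n N) h
  exact ⟨j.unop.unop, toNew n _ N y, (inl_toNew _ _ _ _ _).trans hy⟩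

lemma inl_pb (a : Ideal R) (n : ℕ) (N : ModuleCat.{0} R) (t s : ℕ) (hts : t ≤ s)
    (η : Abelian.Ext (QQ (a ^ t)) N n) :
    inl a n s N (pb (pi (Ideal.pow_le_pow_right hts)) η) = inl a n t N η := by
  obtain ⟨ξ, rfl⟩ := toNew_surj n η
  rw [pb, ← toNew_left, inl_toNew, inl_toNew]
  have := congrArg (fun q => (q.app N).hom ξ)
    (colimit.w (diagram (idealPowersDiagram a) n) (homOfLE hts).op.op)
  exact this

lemma inl_eq_zero (a : Ideal R) (n : ℕ) (N : ModuleCat.{0} R) (t : ℕ)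
    (η : Abelian.Ext (QQ (a ^ t)) N n) (h : inl a n t N η = 0) :
    ∃ s, ∃ hts : t ≤ s, pb (pi (Ideal.pow_le_pow_right (I := a) hts)) η = 0 := by
  obtain ⟨ξ, rfl⟩ := toNew_surj n η
  rw [inl_toNew] at h
  obtain ⟨k, f, g, hfg⟩ := Concrete.isColimit_exists_of_rep_eq _ (isCol a n N)
    (i := op (op t)) (j := op (op t)) ξ (0 : OE n (QQ (a ^ t)) N)
      (h.trans (map_zero (iota a n t N).hom).symm)
  refine ⟨k.unop.unop, leOfHom f.unop.unop, ?_⟩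
  rw [pb, ← toNew_left, toNew_eq_zero]
  refine Eq.trans hfg ?_
  exact map_zero (((diagram (idealPowersDiagram a) n).map g).app N).hom

lemma map_inl (a : Ideal R) (n : ℕ) {N N' : ModuleCat.{0} R} (g : N ⟶ N') (t : ℕ)
    (η : Abelian.Ext (QQ (a ^ t)) N n) :
    ((localCohomology a n).map g).hom (inl a n t N η) = inl a n t N' (pf g η) := by
  obtain ⟨ξ, rfl⟩ := toNew_surj n η
  rw [pf, ← toNew_right, inl_toNew, inl_toNew]
  exact congrArg (fun q => q.hom ξ) 
    ((colimit.ι (diagram (idealPowersDiagram a) n) (op (op t))).naturality g).symm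

lemma smul_inl (a : Ideal R) (n : ℕ) {N : ModuleCat.{0} R} (r : R) (t : ℕ)
    (η : Abelian.Ext (QQ (a ^ t)) N n) :
    r • (inl a n t N η) = inl a n t N (pf (r • 𝟙 N) η) := by
  obtain ⟨ξ, rfl⟩ := toNew_surj n η
  rw [pf, ← toNew_smul, inl_toNew, inl_toNew, map_smul]

/-- local cohomology vanishes -/
def Van (a : Ideal R) (n : ℕ) (N : ModuleCat.{0} R) : Prop :=
  Subsingleton ((localCohomology a n).obj N)

lemma van_iff (a : Ideal R) (n : ℕ) (N : ModuleCat.{0} R) :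
    Van a n N ↔ ∀ t (η : Abelian.Ext (QQ (a ^ t)) N n),
      ∃ s, ∃ hts : t ≤ s, pb (pi (Ideal.pow_le_pow_right (I := a) hts)) η = 0 := by
  constructor
  · intro h t η
    have : Subsingleton ((localCohomology a n).obj N) := h
    exact inl_eq_zero _ _ _ _ _ (Subsingleton.elim _ _)
  · intro h
    refine subsingleton_of_forall_eq 0 fun y => ?_
    obtain ⟨t, η, rfl⟩ := inl_surj a n N y
    obtain ⟨s, hts, hs⟩ := h t η
    rw [← inl_pb a n N t s hts, hs, map_zero]

lemma map_smul_id (a : Ideal R) (n : ℕ) {N : ModuleCat.{0} R} (r : R)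
    (y : (localCohomology a n).obj N) :
    ((localCohomology a n).map (r • 𝟙 N)).hom y = r • y := by
  obtain ⟨t, η, rfl⟩ := inl_surj a n N y
  rw [map_inl, smul_inl]

lemma map_add' (a : Ideal R) (n : ℕ) {N N' : ModuleCat.{0} R} (f g : N ⟶ N')
    (y : (localCohomology a n).obj N) :
    ((localCohomology a n).map (f + g)).hom y =
      ((localCohomology a n).map f).hom y + ((localCohomology a n).map g).hom y := by
  obtain ⟨t, η, rfl⟩ := inl_surj a n N y
  rw [map_inl, map_inl, map_inl, ← map_add, pf, Abelian.Ext.mk₀_add, Abelian.Ext.comp_add]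

instance (a : Ideal R) (n : ℕ) : (localCohomology a n).Additive where
  map_add {_ _ f g} := by
    ext y
    exact map_add' a n f g y

lemma lc_exact (a : Ideal R) (n : ℕ) {S : ShortComplex (ModuleCat.{0} R)} (hS : S.ShortExact)
    (y : (localCohomology a n).obj S.X₂) (hy : ((localCohomology a n).map S.g).hom y = 0) :
    ∃ x, ((localCohomology a n).map S.f).hom x = y := by
  obtain ⟨t, η, rfl⟩ := inl_surj a n _ y
  rw [map_inl] at hy
  obtain ⟨s, hts, hs⟩ := inl_eq_zero _ _ _ _ _ hy
  obtain ⟨x, hx⟩ := Abelian.Ext.covariant_sequence_exact₂ _ hS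
    (pb (pi (Ideal.pow_le_pow_right (I := a) hts)) η) (by
      rw [← hs]; simp [pb, pf])
  refine ⟨inl a n s _ x, ?_⟩
  rw [map_inl, pf, hx, inl_pb _ _ _ _ _ hts]

lemma lc_surj (a : Ideal R) (n : ℕ) {S : ShortComplex (ModuleCat.{0} R)} (hS : S.ShortExact)
    (h : Van a (n+1) S.X₁) (y : (localCohomology a n).obj S.X₃) :
    ∃ x, ((localCohomology a n).map S.g).hom x = y := by
  obtain ⟨t, η, rfl⟩ := inl_surj a n _ y
  obtain ⟨s, hts, hs⟩ := (van_iff _ _ _).1 h t (η.comp hS.extClass rfl)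
  obtain ⟨x, hx⟩ := Abelian.Ext.covariant_sequence_exact₃ _ hS
    (pb (pi (Ideal.pow_le_pow_right (I := a) hts)) η) rfl (by
      rw [← hs, pb, Abelian.Ext.comp_assoc]; omega)
  refine ⟨inl a n s _ x, ?_⟩
  rw [map_inl, pf, hx, inl_pb _ _ _ _ _ hts]

end LCAux


namespace LCAux

variable {R : Type} [CommRing R]

/-- multiplication by `r` as a map `R/I → R/J` -/
def mm {I J : Ideal R} (r : R) (h : ∀ y ∈ I, r * y ∈ J) : QQ I ⟶ QQ J :=
  ModuleCat.ofHom (Submodule.mapQ I J (LinearMap.mulLeft R r) h)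

lemma QQ_ext {I : Ideal R} {N : ModuleCat.{0} R} {f g : QQ I ⟶ N}
    (h : ∀ y : R, f.hom (Submodule.Quotient.mk y) = g.hom (Submodule.Quotient.mk y)) : f = g := by
  apply ModuleCat.hom_ext
  refine LinearMap.ext fun y => ?_
  obtain ⟨y, rfl⟩ := Submodule.Quotient.mk_surjective _ y
  exact h y

lemma mm_mk {I J : Ideal R} (r : R) (h : ∀ y ∈ I, r * y ∈ J) (y : R) :
    (mm r h).hom (Submodule.Quotient.mk y) = Submodule.Quotient.mk (r * y) := rfl

lemma pi_mk {I J : Ideal R} (h : I ≤ J) (y : R) :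
    (pi h).hom (Submodule.Quotient.mk y) = Submodule.Quotient.mk y := rfl

lemma pb_pb {n : ℕ} {L L' L₂ N : ModuleCat.{0} R} (v : L₂ ⟶ L') (u : L' ⟶ L)
    (η : Abelian.Ext L N n) : pb v (pb u η) = pb (v ≫ u) η := by
  simp [pb]

lemma pb_zero_of_factor {n : ℕ} {L L' L₂ N : ModuleCat.{0} R} {w : L₂ ⟶ L} (v : L₂ ⟶ L')
    (u : L' ⟶ L) (hw : w = v ≫ u) {η : Abelian.Ext L N n} (h : pb u η = 0) : pb w η = 0 := by
  rw [hw, ← pb_pb, h, pb, Abelian.Ext.comp_zero]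

lemma pi_pi {I J K : Ideal R} (h : I ≤ J) (h' : J ≤ K) : pi h ≫ pi h' = pi (h.trans h') :=
  QQ_ext fun _ => rfl

/-- the tower `R/J_t` has pro projective dimension at most `d`. -/
def PPD (J : ℕ → Ideal R) (hJ : Antitone J) (d : ℕ) : Prop :=
  ∀ (N : ModuleCat.{0} R) (i t : ℕ), d < i → ∀ η : Abelian.Ext (QQ (J t)) N i,
    ∃ s, ∃ hts : t ≤ s, pb (pi (hJ hts)) η = 0

/-- the short complex `R/(J : x) → R/J → R/(J + x)` -/
noncomputable def SC (J : Ideal R) (x : R) : ShortComplex (ModuleCat.{0} R) where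
  X₁ := QQ (Submodule.comap (LinearMap.mulLeft R x) J)
  X₂ := QQ J
  X₃ := QQ (J ⊔ Ideal.span {x})
  f := mm x (fun _ hy => hy)
  g := pi le_sup_left
  zero := QQ_ext fun y => by
    change (Submodule.Quotient.mk (x * y) : R ⧸ (J ⊔ Ideal.span {x})) = 0
    rw [Submodule.Quotient.mk_eq_zero]
    exact Ideal.mem_sup_right (Ideal.mul_mem_right _ _ (Ideal.mem_span_singleton_self x))

lemma SC_exact (J : Ideal R) (x : R) : (SC J x).ShortExact where
  exact := by
    rw [ShortComplex.moduleCat_exact_iff]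
    intro y hy
    obtain ⟨y, rfl⟩ := Submodule.Quotient.mk_surjective _ y
    change (Submodule.Quotient.mk y : R ⧸ (J ⊔ Ideal.span {x})) = 0 at hy
    rw [Submodule.Quotient.mk_eq_zero, Submodule.mem_sup] at hy
    obtain ⟨j, hj, z, hz, rfl⟩ := hy
    obtain ⟨w, rfl⟩ := Ideal.mem_span_singleton'.1 hz
    refine ⟨Submodule.Quotient.mk w, ?_⟩
    change (Submodule.Quotient.mk (x * w) : R ⧸ J) = Submodule.Quotient.mk (j + w * x)
    rw [Submodule.Quotient.eq]
    convert neg_mem hj using 1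
    ring
  mono_f := by
    rw [ModuleCat.mono_iff_injective]
    refine (injective_iff_map_eq_zero (SC J x).f.hom).2 fun y hy => ?_
    obtain ⟨y, rfl⟩ := Submodule.Quotient.mk_surjective _ y
    change (Submodule.Quotient.mk (x * y) : R ⧸ J) = 0 at hy
    rw [Submodule.Quotient.mk_eq_zero] at hy
    exact (Submodule.Quotient.mk_eq_zero _).2 hy
  epi_g := by
    rw [ModuleCat.epi_iff_surjective]
    intro y
    obtain ⟨y, rfl⟩ := Submodule.Quotient.mk_surjective _ y
    exact ⟨Submodule.Quotient.mk y, rfl⟩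

lemma anti_sup (J : ℕ → Ideal R) (hJ : Antitone J) (x : R) :
    Antitone (fun t => J t ⊔ Ideal.span {x ^ t}) := fun _ _ h =>
  sup_le_sup (hJ h) (Ideal.span_singleton_le_span_singleton.2 (pow_dvd_pow x h))

lemma colon_mem (J : ℕ → Ideal R) (hJ : Antitone J) (x : R) {t s : ℕ} (h : t ≤ s) :
    ∀ y ∈ Submodule.comap (LinearMap.mulLeft R (x ^ s)) (J s),
      x ^ (s - t) * y ∈ Submodule.comap (LinearMap.mulLeft R (x ^ t)) (J t) := by
  intro y hy
  change x ^ t * (x ^ (s - t) * y) ∈ J t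
  rw [← mul_assoc, ← pow_add, Nat.add_sub_cancel' h]
  exact hJ h hy

/-- transition maps of the short exact sequences -/
noncomputable def SCmap (J : ℕ → Ideal R) (hJ : Antitone J) (x : R) {t s : ℕ} (h : t ≤ s) :
    SC (J s) (x ^ s) ⟶ SC (J t) (x ^ t) where
  τ₁ := mm (x ^ (s - t)) (colon_mem J hJ x h)
  τ₂ := pi (hJ h)
  τ₃ := pi (anti_sup J hJ x h)
  comm₁₂ := QQ_ext fun y => by
    change (Submodule.Quotient.mk (x ^ t * (x ^ (s - t) * y)) : R ⧸ J t) =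
      Submodule.Quotient.mk (x ^ s * y)
    rw [← mul_assoc, ← pow_add, Nat.add_sub_cancel' h]
  comm₂₃ := QQ_ext fun y => rfl

variable [IsNoetherianRing R]

lemma colon_stab (J : Ideal R) (x : R) : ∃ u, ∀ s y, x ^ s * y ∈ J → x ^ u * y ∈ J := by
  let f : ℕ →o Ideal R := ⟨fun s => Submodule.comap (LinearMap.mulLeft R (x ^ s)) J, by
    intro s t h y hy
    change x ^ t * y ∈ J
    rw [← Nat.sub_add_cancel h, pow_add, mul_assoc]
    exact J.mul_mem_left _ hy⟩
  obtain ⟨u, hu⟩ := monotone_stabilizes_iff_noetherian.2 ‹IsNoetherianRing R› f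
  refine ⟨u, fun s y h => ?_⟩
  have h1 : y ∈ f (max s u) := f.monotone (le_max_left s u) h
  rw [← hu _ (le_max_right s u)] at h1
  exact h1

lemma colon_kill (J : ℕ → Ideal R) (hJ : Antitone J) (x : R) (d : ℕ) (H : PPD J hJ d)
    (N : ModuleCat.{0} R) (i t : ℕ) (hi : d < i)
    (η : Abelian.Ext (SC (J t) (x ^ t)).X₁ N i) :
    ∃ s, ∃ hts : t ≤ s, pb (SCmap J hJ x hts).τ₁ η = 0 := by
  have hle : ∀ y ∈ J t, (1 : R) * y ∈ Submodule.comap (LinearMap.mulLeft R (x ^ t)) (J t) := by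
    intro y hy
    rw [one_mul]
    exact (J t).mul_mem_left _ hy
  have hle' : ∀ v, ∀ y ∈ J t, x ^ v * y ∈ Submodule.comap (LinearMap.mulLeft R (x ^ t)) (J t) := by
    intro v y hy
    exact (J t).mul_mem_left _ ((J t).mul_mem_left _ hy)
  -- pulling back along `R/J_t → R/(J_t : x^t)` kills after passing to `p`
  obtain ⟨p, htp, hp⟩ := H N i t hi (pb (mm 1 hle) η)
  obtain ⟨u, hu⟩ := colon_stab (J p) x
  have hps : p ≤ p + u := Nat.le_add_right _ _
  refine ⟨p + u, htp.trans hps, ?_⟩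
  have hA : ∀ y ∈ Submodule.comap (LinearMap.mulLeft R (x ^ (p+u))) (J (p+u)),
      x ^ (p + u - t) * y ∈ J p := by
    intro y hy
    have h1 : x ^ u * y ∈ J p := hu (p+u) y (hJ hps hy)
    rw [show p + u - t = (p - t) + u by omega, pow_add, mul_assoc]
    exact (J p).mul_mem_left _ h1
  have : (SCmap J hJ x (htp.trans hps)).τ₁ = mm (x ^ (p + u - t)) hA ≫ pi (hJ htp) ≫ mm 1 hle :=
    QQ_ext fun y => by
      change (Submodule.Quotient.mk (x ^ (p + u - t) * y) : R ⧸ _) =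
        Submodule.Quotient.mk (1 * (x ^ (p + u - t) * y))
      rw [one_mul]
  exact pb_zero_of_factor (mm (x ^ (p + u - t)) hA) (pi (hJ htp) ≫ mm 1 hle) this
    ((pb_pb _ _ _).symm.trans hp)

lemma PPD_step (J : ℕ → Ideal R) (hJ : Antitone J) (x : R) (d : ℕ) (H : PPD J hJ d) :
    PPD (fun t => J t ⊔ Ideal.span {x ^ t}) (anti_sup J hJ x) (d + 1) := by
  intro N i t hi η
  obtain ⟨i, rfl⟩ : ∃ j, i = 1 + j := ⟨i - 1, by omega⟩
  obtain ⟨s, hts, hs⟩ := H N (1 + i) t (by omega) (pb (SC (J t) (x ^ t)).g η)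
  have h1 : pb (SC (J s) (x ^ s)).g (pb (pi (anti_sup J hJ x hts)) η) = 0 := by
    refine (pb_pb _ _ _).trans (Eq.trans ?_ ((pb_pb _ _ _).symm.trans hs))
    exact congrArg (fun w => pb w η) (SCmap J hJ x hts).comm₂₃.symm
  obtain ⟨ζ, hζ⟩ := Abelian.Ext.contravariant_sequence_exact₃ (SC_exact (J s) (x ^ s)) N _ h1 rfl
  obtain ⟨p, hsp, hp⟩ := colon_kill J hJ x d H N i s (by omega) ζ
  refine ⟨p, hts.trans hsp, ?_⟩
  have h2 : pb (pi (anti_sup J hJ x (hts.trans hsp))) η =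
      pb (pi (anti_sup J hJ x hsp)) (pb (pi (anti_sup J hJ x hts)) η) :=
    ((congrArg (fun w => pb w η) (pi_pi (anti_sup J hJ x hsp) (anti_sup J hJ x hts))).symm.trans
      (pb_pb _ _ _).symm)
  refine h2.trans ((congrArg (pb (pi (anti_sup J hJ x hsp))) hζ).symm.trans ?_)
  have h3 := ShortComplex.ShortExact.extClass_naturality (SC_exact (J p) (x ^ p))
    (SC_exact (J s) (x ^ s)) (SCmap J hJ x hsp)
  change (Abelian.Ext.mk₀ (SCmap J hJ x hsp).τ₃).comp _ _ = 0
  rw [← Abelian.Ext.comp_assoc _ _ _ (zero_add 1) (by omega) (by omega), ← h3,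
    Abelian.Ext.comp_assoc _ _ _ (add_zero 1) (zero_add i) (by omega)]
  change Abelian.Ext.comp _ (pb (SCmap J hJ x hsp).τ₁ ζ) _ = 0
  rw [hp, Abelian.Ext.comp_zero]

lemma exists_tower (S : Finset R) : ∃ (d : ℕ) (J : ℕ → Ideal R) (hJ : Antitone J),
    PPD J hJ d ∧ (∀ t, J t ≤ Ideal.span (S : Set R) ^ t) ∧
      ∀ t, ∃ k, Ideal.span (S : Set R) ^ k ≤ J t := by
  classical
  induction S using Finset.induction_on with
  | empty =>
    refine ⟨0, fun _ => ⊥, antitone_const, ?_, fun t => bot_le, fun t => ⟨1, by simp⟩⟩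
    intro N i t hi η
    refine ⟨t, le_rfl, ?_⟩
    have : Projective (QQ (⊥ : Ideal R)) := by
      have : Module.Projective R (R ⧸ (⊥ : Ideal R)) :=
        Module.Projective.of_equiv (Submodule.quotEquivOfEqBot (⊥ : Submodule R R) rfl).symm
      exact ModuleCat.projective_of_categoryTheory_projective (P := QQ (⊥ : Ideal R))
    obtain ⟨i, rfl⟩ : ∃ j, i = j + 1 := ⟨i - 1, by omega⟩
    exact Abelian.Ext.eq_zero_of_projective (P := QQ (⊥ : Ideal R)) _
  | insert x S hx ih =>
    obtain ⟨d, J, hJ, h1, h2, h3⟩ := ih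
    refine ⟨d + 1, _, anti_sup J hJ x, PPD_step J hJ x d h1, ?_, ?_⟩
    · intro t
      rw [Finset.coe_insert, Ideal.span_insert, sup_comm (Ideal.span {x})]
      refine sup_le ((h2 t).trans (Ideal.pow_right_mono le_sup_left t)) ?_
      rw [← Ideal.span_singleton_pow]
      exact Ideal.pow_right_mono le_sup_right t
    · intro t
      obtain ⟨k, hk⟩ := h3 t
      refine ⟨k + t, ?_⟩
      rw [Finset.coe_insert, Ideal.span_insert, sup_comm (Ideal.span {x})]
      refine Ideal.sup_pow_add_le_pow_sup_pow.trans ?_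
      rw [Ideal.span_singleton_pow]
      exact sup_le_sup_right hk _

lemma exists_bound (a : Ideal R) : ∃ d, ∀ i, d < i → ∀ N : ModuleCat.{0} R, Van a i N := by
  obtain ⟨S, rfl⟩ := IsNoetherian.noetherian a
  obtain ⟨d, J, hJ, h1, h2, h3⟩ := exists_tower S
  refine ⟨d, fun i hi N => (van_iff _ _ _).2 fun t η => ?_⟩
  obtain ⟨s, hts, hs⟩ := h1 N i t hi (pb (pi (h2 t)) η)
  obtain ⟨k, hk⟩ := h3 s
  have hk' : Ideal.span (S : Set R) ^ (max k t) ≤ J s :=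
    (Ideal.pow_le_pow_right (le_max_left _ _)).trans hk
  refine ⟨max k t, le_max_right _ _, ?_⟩
  have : pi (Ideal.pow_le_pow_right (I := Ideal.span (S : Set R)) (le_max_right k t)) =
    pi hk' ≫ pi (hJ hts) ≫ pi (h2 t) := QQ_ext fun _ => rfl
  change pb (pi (Ideal.pow_le_pow_right (I := Ideal.span (S : Set R)) (le_max_right k t))) η = 0
  rw [this, ← pb_pb, ← pb_pb, hs, pb, Abelian.Ext.comp_zero]

end LCAux


namespace LCAux

variable {R : Type} [CommRing R]

section
variable {A B C : Type} [AddCommGroup A] [AddCommGroup B] [AddCommGroup C]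
  [Module R A] [Module R B] [Module R C]

/-- short complex of modules attached to an exact pair of linear maps -/
abbrev mkSC (f : A →ₗ[R] B) (g : B →ₗ[R] C) (h : Function.Exact f g) :
    ShortComplex (ModuleCat.{0} R) where
  X₁ := ModuleCat.of R A
  X₂ := ModuleCat.of R B
  X₃ := ModuleCat.of R C
  f := ModuleCat.ofHom f
  g := ModuleCat.ofHom g
  zero := by
    apply ModuleCat.hom_ext
    exact LinearMap.ext fun y => h.apply_apply_eq_zero y

lemma mkSC_exact (f : A →ₗ[R] B) (g : B →ₗ[R] C) (h : Function.Exact f g)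
    (hf : Function.Injective f) (hg : Function.Surjective g) : (mkSC f g h).ShortExact where
  exact := by
    rw [ShortComplex.moduleCat_exact_iff]
    intro y hy
    exact (h y).1 hy
  mono_f := (ModuleCat.mono_iff_injective _).2 hf
  epi_g := (ModuleCat.epi_iff_surjective _).2 hg

lemma van_ext (a : Ideal R) (i : ℕ) (f : A →ₗ[R] B) (g : B →ₗ[R] C) (h : Function.Exact f g)
    (hf : Function.Injective f) (hg : Function.Surjective g)
    (h1 : Van a i (ModuleCat.of R A)) (h3 : Van a i (ModuleCat.of R C)) :
    Van a i (ModuleCat.of R B) := by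
  have h1' : Subsingleton ((localCohomology a i).obj (ModuleCat.of R A)) := h1
  have h3' : Subsingleton ((localCohomology a i).obj (ModuleCat.of R C)) := h3
  refine subsingleton_of_forall_eq 0 fun y => ?_
  obtain ⟨x, hx⟩ := lc_exact a i (mkSC_exact f g h hf hg) y (h3'.elim _ _)
  rw [← hx, h1'.elim x 0]
  exact map_zero _

lemma van_quot (a : Ideal R) (i : ℕ) (g : B →ₗ[R] C) (hg : Function.Surjective g)
    (h1 : Van a (i + 1) (ModuleCat.of R (LinearMap.ker g)))
    (h2 : Van a i (ModuleCat.of R B)) : Van a i (ModuleCat.of R C) := by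
  have h2' : Subsingleton ((localCohomology a i).obj (ModuleCat.of R B)) := h2
  refine subsingleton_of_forall_eq 0 fun y => ?_
  obtain ⟨x, hx⟩ := lc_surj a i (mkSC_exact (LinearMap.ker g).subtype g
    (LinearMap.exact_subtype_ker_map g) (Submodule.injective_subtype _) hg) h1 y
  rw [← hx, h2'.elim x 0]
  exact map_zero _

end

/-- a nonzero map to `R/p` for `p` in the support -/
lemma exists_nonzero_map {M : Type} [AddCommGroup M] [Module R M] [Module.Finite R M]
    (p : Ideal R) [p.IsPrime] (hp : Module.annihilator R M ≤ p) :
    ∃ f : M →ₗ[R] R ⧸ p, f ≠ 0 := by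
  have h1 : (⟨p, ‹_›⟩ : PrimeSpectrum R) ∈ Module.support R M := by
    rw [Module.support_eq_zeroLocus]
    exact hp
  rw [Module.mem_support_iff_nontrivial_residueField_tensorProduct] at h1
  let K := p.ResidueField
  have h1' : Nontrivial (TensorProduct R K M) := h1
  obtain ⟨φ, hφ⟩ : ∃ φ : Module.Dual K (TensorProduct R K M), φ ≠ 0 := exists_ne 0
  let g : M →ₗ[R] K := (φ.restrictScalars R).comp (TensorProduct.mk R K M 1)
  have hg : ∃ m, g m ≠ 0 := by
    by_contra hcon
    push Not at hcon
    apply hφ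
    apply LinearMap.ext
    intro z
    induction z using TensorProduct.induction_on with
    | zero => simp
    | add x y hx hy => rw [map_add, hx, hy]; simp
    | tmul k m =>
      have : (TensorProduct.tmul R k m : TensorProduct R K M) = k • TensorProduct.tmul R 1 m := by
        rw [TensorProduct.smul_tmul', smul_eq_mul, mul_one]
      rw [this, map_smul]
      have h2 : φ (TensorProduct.tmul R 1 m) = 0 := hcon m
      rw [h2]; simp
  obtain ⟨m, hm⟩ := hg
  classical
  obtain ⟨S, hS⟩ := (Module.Finite.fg_top : (⊤ : Submodule R M).FG)
  obtain ⟨⟨s, hs⟩, hb⟩ := IsLocalization.exist_integer_multiples_of_finset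
    (nonZeroDivisors (R ⧸ p)) (S.image g)
  obtain ⟨s, rfl⟩ := Ideal.Quotient.mk_surjective s
  let j : (R ⧸ p) →ₗ[R] K := (IsScalarTower.toAlgHom R (R ⧸ p) K).toLinearMap
  have hj : Function.Injective j := p.injective_algebraMap_quotient_residueField
  have hrange : ∀ y, (s • g) y ∈ LinearMap.range j := by
    intro y
    have hle : (⊤ : Submodule R M) ≤ (LinearMap.range j).comap (s • g) := by
      rw [← hS, Submodule.span_le]
      intro x hx
      obtain ⟨z, hz⟩ := hb (g x) (Finset.mem_image_of_mem _ hx)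
      refine ⟨z, hz.trans ?_⟩
      change (algebraMap R (R ⧸ p) s) • g x = s • g x
      rw [algebraMap_smul]
    exact hle trivial
  refine ⟨(LinearEquiv.ofInjective j hj).symm.toLinearMap.comp
    ((s • g).codRestrict (LinearMap.range j) hrange), fun h0 => ?_⟩
  have h3 := LinearMap.congr_fun h0 m
  simp only [LinearMap.comp_apply, LinearMap.zero_apply, LinearEquiv.coe_coe,
    LinearEquiv.map_eq_zero_iff] at h3
  have h4 : s • g m = 0 := congrArg Subtype.val h3
  have hsp : algebraMap R K s ≠ 0 := by
    rw [IsScalarTower.algebraMap_apply R (R ⧸ p) K]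
    intro h5
    have h7 : Ideal.Quotient.mk p s = 0 :=
      hj (a₁ := Ideal.Quotient.mk p s) (a₂ := 0) (h5.trans (map_zero j).symm)
    rw [h7] at hs
    exact zero_notMem_nonZeroDivisors hs
  rw [Algebra.smul_def] at h4
  exact (mul_ne_zero hsp hm) h4

variable [IsNoetherianRing R]

lemma van_step (a : Ideal R) (i : ℕ) (M : Type) [AddCommGroup M] [Module R M] [Module.Finite R M]
    (hM : Van a i (ModuleCat.of R M))
    (H : ∀ (N : Type) [AddCommGroup N] [Module R N] [Module.Finite R N],
      Module.annihilator R M ≤ Module.annihilator R N → Van a (i + 1) (ModuleCat.of R N))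
    (I : Ideal R) : Module.annihilator R M ≤ I →
    ∀ (N : Type) [AddCommGroup N] [Module R N] [Module.Finite R N],
      I ≤ Module.annihilator R N → Van a i (ModuleCat.of R N) := by
  induction I using IsNoetherian.induction with
  | hgt I ih =>
  intro hI N _ _ hN
  induction hN using IsNoetherianRing.induction_on_isQuotientEquivQuotientPrime R with
  | subsingleton N =>
    intro _
    refine subsingleton_of_forall_eq 0 fun y => ?_
    rw [← one_smul R y, ← map_smul_id, show ((1 : R) • 𝟙 (ModuleCat.of R N)) = 0 by
      apply ModuleCat.hom_ext
      exact LinearMap.ext fun y => Subsingleton.elim (α := N) _ _, Functor.map_zero]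
    rfl
  | exact N₁ N₂ N₃ f g hf hg hfg h1 h3 =>
    intro h
    exact van_ext a i f g hfg hf hg (h1 (h.trans (LinearMap.annihilator_le_of_injective f hf)))
      (h3 (h.trans (LinearMap.annihilator_le_of_surjective g hg)))
  | quotient N q e =>
    intro h
    have hq : Module.annihilator R N = q.1 := by
      rw [e.annihilator_eq, Ideal.annihilator_quotient]
    rw [hq] at h
    rcases lt_or_eq_of_le h with hlt | heq
    · exact ih _ hlt (hI.trans h) N hq.ge
    · have := q.2
      obtain ⟨f, hf⟩ := exists_nonzero_map (M := M) q.1 (hI.trans h)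
      let f' : M →ₗ[R] N := e.symm.toLinearMap.comp f
      have hf' : f' ≠ 0 := fun h0 => hf <| LinearMap.ext fun m =>
        e.symm.injective ((LinearMap.congr_fun h0 m).trans (map_zero _).symm)
      have hV1 : Van a i (ModuleCat.of R (LinearMap.range f')) :=
        van_quot a i f'.rangeRestrict f'.surjective_rangeRestrict
          (H _ (LinearMap.annihilator_le_of_injective _ (Submodule.injective_subtype _))) hM
      have hV3 : Van a i (ModuleCat.of R (N ⧸ LinearMap.range f')) := by
        have hle : q.1 ≤ Module.annihilator R (N ⧸ LinearMap.range f') :=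
          hq.ge.trans (LinearMap.annihilator_le_of_surjective _ (Submodule.mkQ_surjective _))
        refine ih _ (lt_of_le_of_ne (heq.le.trans hle) ?_) (hI.trans (h.trans hle)) _ le_rfl
        intro hcon
        obtain ⟨m, hm⟩ : ∃ m, f m ≠ 0 := by
          by_contra hc
          push Not at hc
          exact hf (LinearMap.ext hc)
        obtain ⟨r, hr⟩ := Ideal.Quotient.mk_surjective (f m)
        apply hm
        rw [← hr, Ideal.Quotient.eq_zero_iff_mem, ← heq, hcon, Module.mem_annihilator]
        intro z
        obtain ⟨z, rfl⟩ := Submodule.mkQ_surjective _ z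
        obtain ⟨w, hw⟩ := Ideal.Quotient.mk_surjective (e z)
        rw [← map_smul, Submodule.mkQ_apply, Submodule.Quotient.mk_eq_zero]
        refine ⟨w • m, ?_⟩
        apply e.injective
        change e (e.symm (f (w • m))) = _
        rw [e.apply_symm_apply, map_smul, map_smul, ← hr, ← hw]
        change Ideal.Quotient.mk q.1 (w * r) = Ideal.Quotient.mk q.1 (r * w)
        rw [mul_comm]
      exact van_ext a i _ _ (LinearMap.exact_subtype_mkQ _) (Submodule.injective_subtype _)
        (Submodule.mkQ_surjective _) hV1 hV3

lemma van_thm (a : Ideal R) (n : ℕ) (M : Type) [AddCommGroup M] [Module R M] [Module.Finite R M]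
    (hM : ∀ i, n < i → Van a i (ModuleCat.of R M)) (i : ℕ) (hi : n < i)
    (N : Type) [AddCommGroup N] [Module R N] [Module.Finite R N]
    (hN : Module.annihilator R M ≤ Module.annihilator R N) : Van a i (ModuleCat.of R N) := by
  obtain ⟨d, hd⟩ := exists_bound a
  have key : ∀ k i, n < i → d < i + k →
      ∀ (N : Type) [AddCommGroup N] [Module R N] [Module.Finite R N],
      Module.annihilator R M ≤ Module.annihilator R N → Van a i (ModuleCat.of R N) := by
    intro k
    induction k with
    | zero => intro i _ h N _ _ _ _; exact hd i h _
    | succ k ih =>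
      intro i hi h
      exact van_step a i M (hM i hi) (ih (i + 1) (by omega) (by omega)) _ le_rfl
  exact key (d + 1) i hi (by omega) N hN

/-- elements of `b` act trivially -/
lemma smul_zero_of_iso (a b : Ideal R) (n : ℕ) (M : ModuleCat.{0} R)
    (hb : Nonempty ((localCohomology a n).obj
        (ModuleCat.of R (M ⧸ (b • ⊤ : Submodule R M))) ≅ (localCohomology a n).obj M))
    (x : R) (hx : x ∈ b) (y : (localCohomology a n).obj M) : x • y = 0 := by
  obtain ⟨e⟩ := hb
  let ee := e.toLinearEquiv
  obtain ⟨z, rfl⟩ := ee.surjective y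
  rw [← map_smul, ← map_smul_id,
    show (x • 𝟙 (ModuleCat.of R (M ⧸ (b • ⊤ : Submodule R M)))) = 0 by
      apply ModuleCat.hom_ext
      refine LinearMap.ext fun y => ?_
      obtain ⟨y, rfl⟩ := Submodule.Quotient.mk_surjective _ y
      exact (Submodule.Quotient.mk_eq_zero _).2 (Submodule.smul_mem_smul hx trivial),
    Functor.map_zero]
  exact map_zero ee

/-- maps of the form `∑ x_j • h_j` with `x_j` killing the cohomology induce zero -/
lemma map_sum_zero (a : Ideal R) (n : ℕ) {M P : ModuleCat.{0} R} (S : Finset R)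
    (h : R → (P ⟶ M)) (hk : ∀ x ∈ S, ∀ y : (localCohomology a n).obj M, x • y = 0)
    (y : (localCohomology a n).obj P) :
    ((localCohomology a n).map (∑ x ∈ S, x • h x)).hom y = 0 := by
  classical
  induction S using Finset.induction_on with
  | empty => rw [Finset.sum_empty, Functor.map_zero]; rfl
  | insert x S hx ih =>
    rw [Finset.sum_insert hx, map_add', ih (fun z hz => hk z (Finset.mem_insert_of_mem hz)),
      add_zero, show x • h x = h x ≫ (x • 𝟙 M) by simp, Functor.map_comp]
    change ((localCohomology a n).map (x • 𝟙 M)).hom (((localCohomology a n).map (h x)).hom y) = 0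
    rw [map_smul_id, hk x (Finset.mem_insert_self _ _)]

lemma main_iso (a I : Ideal R) (n : ℕ) (M : ModuleCat.{0} R) [Module.Finite R M]
    (hM : ∀ i, n < i → Van a i M)
    (hk : ∀ x ∈ I, ∀ y : (localCohomology a n).obj M, x • y = 0) :
    Nonempty ((localCohomology a n).obj (ModuleCat.of R (M ⧸ (I • ⊤ : Submodule R M))) ≅
      (localCohomology a n).obj M) := by
  obtain ⟨S, rfl⟩ := IsNoetherian.noetherian I
  set L : Submodule R M := Ideal.span (S : Set R) • ⊤ with hL
  -- the surjection from a power of `M`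
  let g : (S → M) →ₗ[R] M := ∑ x : S, (x : R) • LinearMap.proj x
  have hgr : LinearMap.range g = L := by
    apply le_antisymm
    · rintro _ ⟨v, rfl⟩
      simp only [g, LinearMap.sum_apply, LinearMap.smul_apply]
      exact sum_mem fun x _ => Submodule.smul_mem_smul (Ideal.subset_span x.2) trivial
    · rw [hL, Submodule.smul_le]
      intro r hr m _
      have : Ideal.span (S : Set R) ≤ (LinearMap.range g).comap (LinearMap.toSpanSingleton R M m) := by
        rw [Ideal.span, Submodule.span_le]
        intro x hx
        classical
        refine ⟨Pi.single ⟨x, hx⟩ m, ?_⟩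
        simp only [g, LinearMap.sum_apply, LinearMap.smul_apply, LinearMap.proj_apply]
        rw [Finset.sum_eq_single (⟨x, hx⟩ : S)]
        · rw [Pi.single_eq_same]; rfl
        · intro b _ hb; rw [Pi.single_eq_of_ne hb, smul_zero]
        · intro hn; exact absurd (Finset.mem_univ _) hn
      exact this hr
  let φ : (S → M) →ₗ[R] L := g.codRestrict L fun v => hgr ▸ LinearMap.mem_range_self g v
  have hφ : Function.Surjective φ := by
    rintro ⟨m, hm⟩
    rw [← hgr] at hm
    obtain ⟨v, hv⟩ := hm
    exact ⟨v, Subtype.ext hv⟩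
  have hann : Module.annihilator R M ≤ Module.annihilator R (S → M) := by
    intro r hr
    rw [Module.mem_annihilator] at hr ⊢
    intro v
    funext x
    exact hr _
  have hsurj := lc_surj a n (mkSC_exact (LinearMap.ker φ).subtype φ
    (LinearMap.exact_subtype_ker_map φ) (Submodule.injective_subtype _) hφ)
    (van_thm a n M hM (n + 1) (by omega) _ (hann.trans
      (LinearMap.annihilator_le_of_injective _ (Submodule.injective_subtype _))))
  have hSE := mkSC_exact L.subtype L.mkQ (LinearMap.exact_subtype_mkQ _)
    (Submodule.injective_subtype _) (Submodule.mkQ_surjective _)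
  have hsurj2 := lc_surj a n hSE (van_thm a n M hM (n + 1) (by omega) _
      (LinearMap.annihilator_le_of_injective _ (Submodule.injective_subtype _)))
  have hzero : ∀ z : (localCohomology a n).obj (ModuleCat.of R L),
      ((localCohomology a n).map (ModuleCat.ofHom L.subtype)).hom z = 0 := by
    intro z
    obtain ⟨w, hw⟩ := hsurj z
    rw [← hw]
    have h1 : ModuleCat.ofHom φ ≫ ModuleCat.ofHom L.subtype = ModuleCat.ofHom g := rfl
    classical
    let hh : R → (ModuleCat.of R (S → M) ⟶ M) := fun x =>
      if hx : x ∈ S then ModuleCat.ofHom (LinearMap.proj ⟨x, hx⟩) else 0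
    have h2 : (ModuleCat.ofHom g : ModuleCat.of R (S → M) ⟶ M) = ∑ x ∈ S, x • hh x := by
      rw [← Finset.sum_coe_sort S]
      apply ModuleCat.hom_ext
      rw [ModuleCat.hom_sum]
      refine Finset.sum_congr rfl fun x _ => ?_
      simp only [hh, x.2, dite_true]
      rfl
    have h3 := map_sum_zero a n S hh (fun x hx => hk x (Ideal.subset_span hx)) w
    rw [← h2, ← h1, Functor.map_comp] at h3
    exact h3
  let q := ((localCohomology a n).map (ModuleCat.ofHom L.mkQ)).hom
  have hq : Function.Bijective q := by
    refine ⟨(injective_iff_map_eq_zero q).2 fun y hy => ?_, hsurj2⟩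
    obtain ⟨z, hz⟩ := lc_exact a n hSE y hy
    exact hz.symm.trans (hzero z)
  exact ⟨(LinearEquiv.ofBijective q hq).symm.toModuleIso⟩

end LCAux

theorem stmt4 {R : Type} [CommRing R] [IsNoetherianRing R]
    (a b c : Ideal R) (M : ModuleCat R) [Module.Finite R M]
    (n : ℕ) (hcd : HasCD a M n)
    (hb : Nonempty ((localCohomology a n).obj
        (ModuleCat.of R (M ⧸ (b • ⊤ : Submodule R M))) ≅ (localCohomology a n).obj M))
    (hc : Nonempty ((localCohomology a n).obj
        (ModuleCat.of R (M ⧸ (c • ⊤ : Submodule R M))) ≅ (localCohomology a n).obj M)) :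
    Nonempty ((localCohomology a n).obj
        (ModuleCat.of R (M ⧸ (b • ⊤ ⊔ c • ⊤ : Submodule R M))) ≅
      (localCohomology a n).obj M) := by
  rw [← Submodule.sup_smul]
  refine LCAux.main_iso a (b ⊔ c) n M hcd.2 fun x hx y => ?_
  obtain ⟨u, hu, v, hv, rfl⟩ := Submodule.mem_sup.1 hx
  rw [add_smul, LCAux.smul_zero_of_iso a b n M hb u hu, LCAux.smul_zero_of_iso a c n M hc v hv,
    add_zero]
end

section
/- Let R be a Noetherian ring, M a finitely generated R-module, and 𝔞 an ideal with c := cd(𝔞, M) finite. Then the set Σ := { 𝔠 ideal of R : H^c_𝔞(M) ≅ H^c_𝔞(M/𝔠M) } has a largest element with respect to inclusion, and that largest element equals Ann_R(H^c_𝔞(M)). -/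
open CategoryTheory

open CategoryTheory Limits Opposite

namespace LC
variable {R : Type} [CommRing R]

abbrev OpCx (R : Type) [CommRing R] := ChainComplex (ModuleCat.{0} R)ᵒᵖ ℕ

def HRel (K : OpCx R) (n : ℕ) (f : (K.X n).unop) (e : (K.homology n).unop) : Prop :=
  ∃ z : (K.opcycles n).unop, (K.pOpcycles n).unop z = f ∧ (K.homologyι n).unop z = e

lemma HRel.exists_rep (K : OpCx R) (n : ℕ) (e : (K.homology n).unop) :
    ∃ f, (K.d (n+1) n).unop f = 0 ∧ HRel K n f e := by
  have : Function.Surjective (K.homologyι n).unop :=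
    (ModuleCat.epi_iff_surjective _).1 inferInstance
  obtain ⟨z, hz⟩ := this e
  refine ⟨_, ?_, z, rfl, hz⟩
  have h : K.d (n+1) n ≫ K.pOpcycles n = 0 := by simp
  have h2 := congrArg Quiver.Hom.unop h
  rw [unop_comp] at h2
  exact congr($h2 z)

lemma HRel.exists_of_cocycle (K : OpCx R) (n : ℕ) (f : (K.X n).unop)
    (hf : (K.d (n+1) n).unop f = 0) : ∃ e, HRel K n f e := by
  have h1 := ShortComplex.exact_of_g_is_cokernel
    (ShortComplex.mk (K.d (n+1) n) (K.pOpcycles n) (by simp))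
    (K.opcyclesIsCokernel (n+1) n (by simp))
  have h2 := (ShortComplex.moduleCat_exact_iff _).1 h1.unop
  obtain ⟨z, hz⟩ := h2 f hf
  exact ⟨_, z, hz, rfl⟩

lemma HRel.zero_iff (K : OpCx R) (n : ℕ) (f : (K.X n).unop) (e) (h : HRel K n f e) :
    e = 0 ↔ ∃ g : (K.X (n-1)).unop, (K.d n (n-1)).unop g = f := by
  obtain ⟨z, rfl, rfl⟩ := h
  have hd : K.pOpcycles n ≫ K.fromOpcycles n (n-1) = K.d n (n-1) := by simp
  have hmono : Function.Injective (K.pOpcycles n).unop :=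
    (ModuleCat.mono_iff_injective _).1 inferInstance
  have hd2 := congrArg Quiver.Hom.unop hd
  rw [unop_comp] at hd2
  have hdz : ∀ g, (K.pOpcycles n).unop ((K.fromOpcycles n (n-1)).unop g)
    = (K.d n (n-1)).unop g := fun g => congr($hd2 g)
  constructor
  · intro hz
    rcases Nat.eq_zero_or_pos n with rfl | hn
    · have : Mono (K.homologyι 0).unop := by
        have : IsIso (K.homologyι 0) := K.isIso_homologyι _ _ rfl (by simp)
        infer_instance
      have hz0 : z = 0 := (ModuleCat.mono_iff_injective _).1 this (by rw [hz]; simp)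
      exact ⟨0, by simp [hz0]⟩
    · have h1 := ShortComplex.exact_of_f_is_kernel
        (ShortComplex.mk (K.homologyι n) (K.fromOpcycles n (n-1)) (by simp))
        (K.homologyIsKernel n (n-1) (by
          apply ComplexShape.next_eq'
          simp only [ComplexShape.down_Rel]; omega))
      have h2 := (ShortComplex.moduleCat_exact_iff _).1 h1.unop
      obtain ⟨g, hg⟩ := h2 z hz
      exact ⟨g, (hdz g).symm.trans (congrArg _ hg)⟩
  · rintro ⟨g, hg⟩
    have : (K.fromOpcycles n (n-1)).unop g = z := hmono (by rw [hdz, hg])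
    rw [← this]
    have h : K.homologyι n ≫ K.fromOpcycles n (n-1) = 0 := by simp
    have h2 := congrArg Quiver.Hom.unop h
    rw [unop_comp] at h2
    exact congr($h2 g)

lemma HRel.map {K L : OpCx R} (φ : K ⟶ L) (n : ℕ) {f e} (h : HRel L n f e) :
    HRel K n ((φ.f n).unop f) ((HomologicalComplex.homologyMap φ n).unop e) := by
  obtain ⟨z, rfl, rfl⟩ := h
  refine ⟨(HomologicalComplex.opcyclesMap φ n).unop z, ?_, ?_⟩
  · have h := congrArg Quiver.Hom.unop (HomologicalComplex.p_opcyclesMap φ n)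
    rw [unop_comp, unop_comp] at h
    exact congr($h z)
  · have h := congrArg Quiver.Hom.unop (HomologicalComplex.homologyι_naturality φ n)
    rw [unop_comp, unop_comp] at h
    exact congr($h z).symm

lemma HRel.add {K : OpCx R} {n : ℕ} {f e f' e'} (h : HRel K n f e) (h' : HRel K n f' e') :
    HRel K n (f + f') (e + e') := by
  obtain ⟨z, rfl, rfl⟩ := h
  obtain ⟨z', rfl, rfl⟩ := h'
  exact ⟨z + z', by simp, by simp⟩

lemma HRel.smul {K : OpCx R} {n : ℕ} {f e} (r : R) (h : HRel K n f e) :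
    HRel K n (r • f) (r • e) := by
  obtain ⟨z, rfl, rfl⟩ := h
  exact ⟨r • z, by simp, by simp⟩

/-- the functor -/
abbrev Y (N : ModuleCat.{0} R) : ModuleCat.{0} R ⥤ (ModuleCat.{0} R)ᵒᵖ :=
  ((linearYoneda R (ModuleCat.{0} R)).obj N).rightOp

abbrev YC (N : ModuleCat.{0} R) {X : ModuleCat.{0} R} (P : ProjectiveResolution X) : OpCx R :=
  ((Y N).mapHomologicalComplex _).obj P.complex

noncomputable abbrev E (X N : ModuleCat.{0} R) (n : ℕ) : ModuleCat.{0} R :=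
  ((Ext R (ModuleCat.{0} R) n).obj (op X)).obj N

def ERel {X N : ModuleCat.{0} R} (P : ProjectiveResolution X) (n : ℕ) (f : P.complex.X n ⟶ N)
    (e : E X N n) : Prop :=
  ∃ e', HRel (YC N P) n f e' ∧ e = (P.isoLeftDerivedObj (Y N) n).hom.unop e'

section
variable {X N : ModuleCat.{0} R} (P : ProjectiveResolution X) (n : ℕ)

lemma ERel.exists_rep (e : E X N n) :
    ∃ f, P.complex.d (n+1) n ≫ f = 0 ∧ ERel P n f e := by
  obtain ⟨f, hf, h⟩ := HRel.exists_rep (YC N P) n ((P.isoLeftDerivedObj (Y N) n).inv.unop e)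
  refine ⟨f, hf, _, h, ?_⟩
  have h := congrArg Quiver.Hom.unop (P.isoLeftDerivedObj (Y N) n).hom_inv_id
  rw [unop_comp] at h
  exact congr($h e).symm

lemma ERel.exists_of_cocycle (f : P.complex.X n ⟶ N)
    (hf : P.complex.d (n+1) n ≫ f = 0) : ∃ e, ERel P n f e := by
  obtain ⟨e, h⟩ := HRel.exists_of_cocycle (YC N P) n f hf
  exact ⟨_, _, h, rfl⟩

variable {P n}
lemma ERel.zero_iff {f e} (h : ERel (N := N) P n f e) :
    e = 0 ↔ ∃ g : P.complex.X (n-1) ⟶ N, P.complex.d n (n-1) ≫ g = f := by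
  obtain ⟨e', h, rfl⟩ := h
  refine Iff.trans ?_ (HRel.zero_iff _ _ _ _ h)
  have : Function.Injective (P.isoLeftDerivedObj (Y N) n).hom.unop :=
    (ModuleCat.mono_iff_injective _).1 inferInstance
  exact map_eq_zero_iff _ this

lemma ERel.add {f e f' e'} (h : ERel (N := N) P n f e) (h' : ERel P n f' e') :
    ERel P n (f + f') (e + e') := by
  obtain ⟨e, h, rfl⟩ := h
  obtain ⟨e', h', rfl⟩ := h'
  exact ⟨_, h.add h', (map_add _ _ _).symm⟩

lemma ERel.smul (r : R) {f e} (h : ERel (N := N) P n f e) :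
    ERel P n (r • f) (r • e) := by
  obtain ⟨e, h, rfl⟩ := h
  exact ⟨_, h.smul r, (map_smul _ _ _).symm⟩

lemma ERel.map {N' : ModuleCat.{0} R} (u : N ⟶ N') {f e} (h : ERel (N := N) P n f e) :
    ERel P n (f ≫ u) (((Ext R (ModuleCat.{0} R) n).obj (op X)).map u e) := by
  obtain ⟨e, h, rfl⟩ := h
  refine ⟨_, h.map ((NatTrans.mapHomologicalComplex
    (NatTrans.rightOp ((linearYoneda R (ModuleCat.{0} R)).map u)) _).app P.complex), ?_⟩
  have h1 := P.leftDerived_app_eq (NatTrans.rightOp ((linearYoneda R (ModuleCat.{0} R)).map u)) n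
  have h2 := congrArg (fun t => t ≫ (P.isoLeftDerivedObj (Y N) n).hom) h1
  simp only [Category.assoc, Iso.inv_hom_id, Category.comp_id] at h2
  have h3 := congrArg Quiver.Hom.unop h2
  rw [unop_comp, unop_comp] at h3
  exact congr($h3 e)

lemma ERel.mapLeft {X' : ModuleCat.{0} R} {P' : ProjectiveResolution X'} (u : X' ⟶ X)
    (φ : P'.complex ⟶ P.complex) (hφ : φ.f 0 ≫ P.π.f 0 = P'.π.f 0 ≫ u)
    {f e} (h : ERel (N := N) P n f e) :
    ERel P' n (φ.f n ≫ f) (((Ext R (ModuleCat.{0} R) n).map u.op).app N e) := by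
  obtain ⟨e, h, rfl⟩ := h
  refine ⟨_, h.map (((Y N).mapHomologicalComplex _).map φ), ?_⟩
  have h1 := ProjectiveResolution.isoLeftDerivedObj_hom_naturality u P' P φ hφ (Y N) n
  have h3 := congrArg Quiver.Hom.unop h1
  rw [unop_comp, unop_comp] at h3
  exact congr($h3 e)
end
end LC

open CategoryTheory Limits Opposite

namespace LC
variable {R : Type} [CommRing R]

noncomputable abbrev Pt (a : Ideal R) (t : ℕ) : ProjectiveResolution (ModuleCat.of R (R ⧸ a ^ t)) :=
  projectiveResolution _

noncomputable abbrev H (a : Ideal R) (i : ℕ) (N : ModuleCat.{0} R) : ModuleCat.{0} R :=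
  (localCohomology a i).obj N

noncomputable abbrev Di (a : Ideal R) (i : ℕ) :=
  localCohomology.diagram (localCohomology.idealPowersDiagram a) i

noncomputable def io (a : Ideal R) (i : ℕ) (N : ModuleCat.{0} R) (t : ℕ) :
    E (ModuleCat.of R (R ⧸ a ^ t)) N i ⟶ H a i N :=
  (colimit.ι (Di a i) (op (op t))).app N

abbrev tr (a : Ideal R) {s t : ℕ} (h : t ≤ s) :
    ModuleCat.of R (R ⧸ a ^ s) ⟶ ModuleCat.of R (R ⧸ a ^ t) :=
  ModuleCat.ofHom <| Submodule.mapQ _ _ LinearMap.id (Ideal.pow_le_pow_right h)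

lemma io_map (a : Ideal R) (i : ℕ) {N N' : ModuleCat.{0} R} (u : N ⟶ N') (t : ℕ) (e) :
    (localCohomology a i).map u (io a i N t e) =
      io a i N' t (((Ext R (ModuleCat.{0} R) i).obj (op _)).map u e) := by
  have := (colimit.ι (Di a i) (op (op t))).naturality u
  exact congr($this e).symm

lemma io_tr (a : Ideal R) (i : ℕ) (N : ModuleCat.{0} R) {s t : ℕ} (h : t ≤ s) (e) :
    io a i N s (((Ext R (ModuleCat.{0} R) i).map (tr a h).op).app N e) = io a i N t e := by
  have := congr(($(colimit.w (Di a i) (homOfLE h).op.op)).app N)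
  exact congr($this e)

instance : IsFiltered ((ℕᵒᵖ)ᵒᵖ) := inferInstance

noncomputable def ev (a : Ideal R) (i : ℕ) (N : ModuleCat.{0} R) :
    IsColimit (((evaluation _ _).obj N).mapCocone (colimit.cocone (Di a i))) :=
  isColimitOfPreserves _ (colimit.isColimit (Di a i))

lemma io_surj (a : Ideal R) (i : ℕ) (N : ModuleCat.{0} R) (y : H a i N) :
    ∃ t e, io a i N t e = y := by
  obtain ⟨j, e, h⟩ := Concrete.isColimit_exists_rep _ (ev a i N) y
  exact ⟨j.unop.unop, e, h⟩

lemma io_zero (a : Ideal R) (i : ℕ) (N : ModuleCat.{0} R) (t : ℕ) (e)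
    (h : io a i N t e = 0) :
    ∃ s, ∃ h : t ≤ s, ((Ext R (ModuleCat.{0} R) i).map (tr a h).op).app N e = 0 := by
  have h0 : io a i N t e = io a i N t 0 := by rw [h, map_zero]
  obtain ⟨k, f, g, hk⟩ := Concrete.isColimit_exists_of_rep_eq
    (F := Di a i ⋙ (evaluation _ _).obj N) (i := op (op t)) (j := op (op t)) (ev a i N) e 0 h0
  refine ⟨k.unop.unop, leOfHom f.unop.unop, ?_⟩
  rw [map_zero] at hk
  exact hk

/-- the chosen lift -/
noncomputable abbrev lf (a : Ideal R) {s t : ℕ} (h : t ≤ s) :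
    (Pt a s).complex ⟶ (Pt a t).complex :=
  ProjectiveResolution.lift (tr a h) (Pt a s) (Pt a t)

def Rep (a : Ideal R) {i : ℕ} {N : ModuleCat.{0} R} (t : ℕ) (f : (Pt a t).complex.X i ⟶ N)
    (y : H a i N) : Prop := ∃ e, ERel (Pt a t) i f e ∧ io a i N t e = y

/-- coboundary -/
def Cob (a : Ideal R) {i : ℕ} {N : ModuleCat.{0} R} (t : ℕ)
    (f : (Pt a t).complex.X i ⟶ N) : Prop :=
  ∃ g : (Pt a t).complex.X (i-1) ⟶ N, (Pt a t).complex.d i (i-1) ≫ g = f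

variable {a : Ideal R} {i : ℕ} {N : ModuleCat.{0} R} {t : ℕ}

lemma Rep.exists_rep (y : H a i N) :
    ∃ t f, (Pt a t).complex.d (i+1) i ≫ f = 0 ∧ Rep a t f y := by
  obtain ⟨t, e, rfl⟩ := io_surj a i N y
  obtain ⟨f, hf, h⟩ := ERel.exists_rep (Pt a t) i e
  exact ⟨t, f, hf, e, h, rfl⟩

lemma Rep.exists_of_cocycle (f : (Pt a t).complex.X i ⟶ N)
    (hf : (Pt a t).complex.d (i+1) i ≫ f = 0) : ∃ y, Rep a t f y := by
  obtain ⟨e, h⟩ := ERel.exists_of_cocycle (Pt a t) i f hf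
  exact ⟨_, e, h, rfl⟩

lemma Rep.add {f f' : (Pt a t).complex.X i ⟶ N} {y y'} (h : Rep a t f y) (h' : Rep a t f' y') :
    Rep a t (f + f') (y + y') := by
  obtain ⟨e, h, rfl⟩ := h
  obtain ⟨e', h', rfl⟩ := h'
  exact ⟨_, h.add h', map_add _ _ _⟩

lemma Rep.smul (r : R) {f : (Pt a t).complex.X i ⟶ N} {y} (h : Rep a t f y) :
    Rep a t (r • f) (r • y) := by
  obtain ⟨e, h, rfl⟩ := h
  exact ⟨_, h.smul r, map_smul _ _ _⟩

lemma Rep.sub {f f' : (Pt a t).complex.X i ⟶ N} {y y'} (h : Rep a t f y) (h' : Rep a t f' y') :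
    Rep a t (f - f') (y - y') := by
  have := h.add (h'.smul (-1))
  rw [sub_eq_add_neg, sub_eq_add_neg]
  simpa using this

lemma Rep.map {N' : ModuleCat.{0} R} (u : N ⟶ N') {f : (Pt a t).complex.X i ⟶ N} {y}
    (h : Rep a t f y) : Rep a t (f ≫ u) ((localCohomology a i).map u y) := by
  obtain ⟨e, h, rfl⟩ := h
  exact ⟨_, h.map u, (io_map _ _ _ _ _).symm⟩

lemma Rep.lift {s : ℕ} (hs : t ≤ s) {f : (Pt a t).complex.X i ⟶ N} {y}
    (h : Rep a t f y) : Rep a s ((lf a hs).f i ≫ f) y := by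
  obtain ⟨e, h, rfl⟩ := h
  exact ⟨_, h.mapLeft (tr a hs) _ (ProjectiveResolution.lift_commutes_zero _ _ _), io_tr _ _ _ _ _⟩

lemma Rep.of_zero {f : (Pt a t).complex.X i ⟶ N} (h : Rep a t f 0) :
    ∃ s, ∃ hs : t ≤ s, Cob a s ((lf a hs).f i ≫ f) := by
  obtain ⟨e, h, h0⟩ := h
  obtain ⟨s, hs, h1⟩ := io_zero _ _ _ _ _ h0
  exact ⟨s, hs, (ERel.zero_iff (h.mapLeft (tr a hs) _
    (ProjectiveResolution.lift_commutes_zero _ _ _))).1 h1⟩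

lemma Rep.zero {f : (Pt a t).complex.X i ⟶ N} {y} (h : Rep a t f y) (hf : Cob a t f) : y = 0 := by
  obtain ⟨e, h, rfl⟩ := h
  rw [(ERel.zero_iff h).2 hf, map_zero]

lemma Rep.unique {f : (Pt a t).complex.X i ⟶ N} {y y'} (h : Rep a t f y) (h' : Rep a t f y') :
    y = y' := by
  have := (h.sub h').zero ⟨0, by simp⟩
  exact sub_eq_zero.1 this

end LC

open CategoryTheory Limits Opposite

namespace LC
variable {R : Type} [CommRing R]

/-- short exact sequence -/
structure Ses {A B C : ModuleCat.{0} R} (u : A ⟶ B) (v : B ⟶ C) : Prop where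
  mono : Mono u
  epi : Epi v
  w : u ≫ v = 0
  fac : ∀ {P : ModuleCat.{0} R} (f : P ⟶ B), f ≫ v = 0 → ∃ h : P ⟶ A, h ≫ u = f

lemma Ses.mk' {A B C : ModuleCat.{0} R} (u : A ⟶ B) (v : B ⟶ C)
    (hu : Function.Injective u) (hv : Function.Surjective v) (h : Function.Exact u v) :
    Ses u v where
  mono := (ModuleCat.mono_iff_injective _).2 hu
  epi := (ModuleCat.epi_iff_surjective _).2 hv
  w := by ext x; exact (h _).2 ⟨x, rfl⟩
  fac := by
    intro P f hf
    have : Mono u := (ModuleCat.mono_iff_injective _).2 hu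
    have w : u ≫ v = 0 := by ext x; exact (h _).2 ⟨x, rfl⟩
    have he : (ShortComplex.mk u v w).Exact := by
      rw [ShortComplex.moduleCat_exact_iff]
      intro x hx
      exact (h x).1 hx
    have : Mono (ShortComplex.mk u v w).f := ‹Mono u›
    exact ⟨he.lift f hf, he.lift_f _ _⟩

variable {A B C : ModuleCat.{0} R} {u : A ⟶ B} {v : B ⟶ C} {a : Ideal R}

lemma proj_lift (hS : Ses u v) {t i : ℕ} (f : (Pt a t).complex.X i ⟶ C) :
    ∃ g : (Pt a t).complex.X i ⟶ B, g ≫ v = f := by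
  have := hS.epi
  exact ⟨Projective.factorThru f v, by simp⟩

lemma mid_exact (hS : Ses u v) (i : ℕ) (y : H a i B) (hy : (localCohomology a i).map v y = 0) :
    ∃ z, (localCohomology a i).map u z = y := by
  have := hS.mono
  obtain ⟨t, f, hf, hr⟩ := Rep.exists_rep y
  have h1 := hr.map v
  rw [hy] at h1
  obtain ⟨s, hs, g, hg⟩ := h1.of_zero
  have hr := hr.lift hs
  have hf : (Pt a s).complex.d (i+1) i ≫ ((lf a hs).f i ≫ f) = 0 := by
    rw [← HomologicalComplex.Hom.comm_assoc, hf, comp_zero]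
  rw [← Category.assoc] at hg
  generalize (lf a hs).f i ≫ f = f' at *
  obtain ⟨g', rfl⟩ := proj_lift hS g
  obtain ⟨h, hh⟩ := hS.fac (f' - (Pt a s).complex.d i (i-1) ≫ g') (by simp [hg])
  have hc : (Pt a s).complex.d (i+1) i ≫ h = 0 := by
    rw [← cancel_mono u, Category.assoc, hh]; simp [hf]
  obtain ⟨z, hz⟩ := Rep.exists_of_cocycle h hc
  refine ⟨z, ?_⟩
  have h2 := (hr.sub (hz.map u)).zero ⟨g', by rw [hh]; simp⟩
  exact (sub_eq_zero.1 h2).symm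

lemma surj_of (hS : Ses u v) (i : ℕ) (h0 : Subsingleton (H a (i+1) A)) :
    Function.Surjective ((localCohomology a i).map v) := by
  have := hS.mono
  intro y
  obtain ⟨t, f, hf, hr⟩ := Rep.exists_rep y
  obtain ⟨f', rfl⟩ := proj_lift hS f
  obtain ⟨h, hh⟩ := hS.fac ((Pt a t).complex.d (i+1) i ≫ f') (by simpa using hf)
  have hc : (Pt a t).complex.d (i+1+1) (i+1) ≫ h = 0 := by
    rw [← cancel_mono u, Category.assoc, hh]; simp
  obtain ⟨z, hz⟩ := Rep.exists_of_cocycle h hc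
  rw [Subsingleton.elim z 0] at hz
  obtain ⟨s, hs, k, hk⟩ := hz.of_zero
  change (Pt a s).complex.X i ⟶ A at k
  change (Pt a s).complex.d (i+1) i ≫ k = _ at hk
  have hr := hr.lift hs
  obtain ⟨y', hy'⟩ := Rep.exists_of_cocycle (a := a) (t := s) (i := i) (N := B)
    ((lf a hs).f i ≫ f' - k ≫ u) (by
      rw [Preadditive.comp_sub, ← Category.assoc _ k u, hk, Category.assoc, hh, ← HomologicalComplex.Hom.comm_assoc, sub_self])
  refine ⟨y', ?_⟩
  have h3 := hy'.map v
  have : ((lf a hs).f i ≫ f' - k ≫ u) ≫ v = (lf a hs).f i ≫ f' ≫ v := by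
    simp [hS.w]
  rw [this] at h3
  exact h3.unique hr

lemma van_left (hS : Ses u v) (i : ℕ) (hs : Function.Surjective ((localCohomology a i).map v))
    (h0 : Subsingleton (H a (i+1) B)) : Subsingleton (H a (i+1) A) := by
  have := hS.mono
  refine subsingleton_of_forall_eq 0 fun x => ?_
  obtain ⟨t, h, hh, hr⟩ := Rep.exists_rep x
  have h1 := hr.map u
  rw [Subsingleton.elim ((localCohomology a (i+1)).map u x : H a (i+1) B) 0] at h1
  obtain ⟨s, hts, g, hg⟩ := h1.of_zero
  change (Pt a s).complex.X i ⟶ B at g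
  change (Pt a s).complex.d (i+1) i ≫ g = _ at hg
  rw [← Category.assoc] at hg
  have hr := hr.lift hts
  generalize (lf a hts).f (i+1) ≫ h = h' at *
  obtain ⟨w, hw⟩ := Rep.exists_of_cocycle (g ≫ v) (by rw [← Category.assoc, hg, Category.assoc, hS.w, comp_zero])
  obtain ⟨w', rfl⟩ := hs w
  obtain ⟨t', f, hf, hrf⟩ := Rep.exists_rep w'
  have key : ∃ s, ∃ (h' : (Pt a s).complex.X (i+1) ⟶ A) (g : (Pt a s).complex.X i ⟶ B)
      (f : (Pt a s).complex.X i ⟶ B), (Pt a s).complex.d (i+1) i ≫ g = h' ≫ u ∧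
      Rep a s h' x ∧ (Pt a s).complex.d (i+1) i ≫ f = 0 ∧ Cob a s (f ≫ v - g ≫ v) := by
    have mv : ∀ (s s' : ℕ) (hss : s ≤ s') (h' : (Pt a s).complex.X (i+1) ⟶ A)
      (g : (Pt a s).complex.X i ⟶ B), (Pt a s).complex.d (i+1) i ≫ g = h' ≫ u → 
      (Pt a s').complex.d (i+1) i ≫ ((lf a hss).f i ≫ g) = ((lf a hss).f (i+1) ≫ h') ≫ u := by
      intro s s' hss h' g hg
      rw [← HomologicalComplex.Hom.comm_assoc, hg, Category.assoc]
    have mv0 : ∀ (s s' : ℕ) (hss : s ≤ s') (g : (Pt a s).complex.X i ⟶ B),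
      (Pt a s).complex.d (i+1) i ≫ g = 0 → 
      (Pt a s').complex.d (i+1) i ≫ ((lf a hss).f i ≫ g) = 0 := by
      intro s s' hss g hg
      rw [← HomologicalComplex.Hom.comm_assoc, hg, comp_zero]
    have e1 := (hrf.lift (le_max_right s t')).map v
    have e2 := hw.lift (le_max_left s t')
    have e3 := e1.sub e2
    rw [sub_self] at e3
    obtain ⟨r, hr', hcob⟩ := e3.of_zero
    refine ⟨r, _, _, (lf a hr').f i ≫ _, mv _ _ hr' _ _ (mv _ _ (le_max_left s t') _ _ hg),
      (hr.lift _).lift _, mv0 _ _ hr' _ (mv0 _ _ (le_max_right s t') _ hf), ?_⟩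
    simpa using hcob
  obtain ⟨s, h, g, f, hg, hr, hf, k, hk⟩ := key
  obtain ⟨k', rfl⟩ := proj_lift hS k
  obtain ⟨l, hl⟩ := hS.fac (f - g - (Pt a s).complex.d i (i-1) ≫ k') (by simp [hk])
  refine hr.zero ⟨-l, ?_⟩
  change (Pt a s).complex.d (i+1) i ≫ (-l) = h
  rw [← cancel_mono u, ← hg, Preadditive.comp_neg, Preadditive.neg_comp, Category.assoc, hl]
  simp [hf]

lemma van_mid (hS : Ses u v) (i : ℕ) (hA : Subsingleton (H a i A))
    (hC : Subsingleton (H a i C)) : Subsingleton (H a i B) := by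
  refine subsingleton_of_forall_eq 0 fun y => ?_
  obtain ⟨z, rfl⟩ := mid_exact (a := a) hS i y (Subsingleton.elim _ _)
  rw [Subsingleton.elim z 0, map_zero]

lemma van_right (hS : Ses u v) (i : ℕ) (hA : Subsingleton (H a (i+1) A))
    (hB : Subsingleton (H a i B)) : Subsingleton (H a i C) :=
  (surj_of hS i hA).subsingleton

lemma van_inj (I : ModuleCat.{0} R) [Injective I] (i : ℕ) : Subsingleton (H a (i+1) I) := by
  refine subsingleton_of_forall_eq 0 fun y => ?_
  obtain ⟨t, f, hf, hr⟩ := Rep.exists_rep y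
  have he := (Pt a t).exact_succ i
  refine hr.zero ⟨he.descToInjective f hf, he.comp_descToInjective _ _⟩

lemma map_add' {N N' : ModuleCat.{0} R} (f g : N ⟶ N') (i : ℕ) (y : H a i N) :
    (localCohomology a i).map (f + g) y =
      (localCohomology a i).map f y + (localCohomology a i).map g y := by
  obtain ⟨t, c, hc, hr⟩ := Rep.exists_rep y
  have := (hr.map f).add (hr.map g)
  rw [← Preadditive.comp_add] at this
  exact (hr.map _).unique this

lemma map_smul' {N N' : ModuleCat.{0} R} (f : N ⟶ N') (r : R) (i : ℕ) (y : H a i N) :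
    (localCohomology a i).map (r • f) y = r • (localCohomology a i).map f y := by
  obtain ⟨t, c, hc, hr⟩ := Rep.exists_rep y
  have := (hr.map f).smul r
  rw [← Linear.comp_smul] at this
  exact (hr.map _).unique this

lemma van_iso {N N' : ModuleCat.{0} R} (e : N ≅ N') (i : ℕ) (h : Subsingleton (H a i N)) :
    Subsingleton (H a i N') :=
  ((localCohomology a i).mapIso e).symm.toLinearEquiv.injective.subsingleton

/-- torsion: if x in a acts bijectively on N then cohomology vanishes. -/
lemma van_of_inv (N : ModuleCat.{0} R) (x : R) (hx : x ∈ a) (g : N ⟶ N) (hg : x • g = 𝟙 N)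
    (i : ℕ) : Subsingleton (H a i N) := by
  refine subsingleton_of_forall_eq 0 fun y => ?_
  obtain ⟨t, f, hf, hr⟩ := Rep.exists_rep y
  have hh : Homotopy ((x ^ t) • 𝟙 (Pt a t).complex) 0 := by
    apply ProjectiveResolution.liftHomotopyZero
    have h0 : (x ^ t) • 𝟙 (ModuleCat.of R (R ⧸ a ^ t)) = 0 := by
      ext
      change Submodule.Quotient.mk (x ^ t • 1) = (0 : R ⧸ a ^ t)
      rw [Submodule.Quotient.mk_eq_zero]
      simpa using Ideal.pow_mem_pow hx t
    rw [Linear.smul_comp, Category.id_comp]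
    ext : 1
    rw [HomologicalComplex.smul_f_apply]
    rw [← Category.comp_id ((Pt a t).π.f 0), ← Linear.comp_smul]
    erw [h0]
    exact comp_zero
  have h1 : Cob a t ((x ^ t) • f) := by
    have := hh.comm i
    have h2 : (x ^ t) • f = ((x ^ t) • 𝟙 (Pt a t).complex : _).f i ≫ f := by
      rw [HomologicalComplex.smul_f_apply]; simp
    rw [h2, this]
    rcases i with _ | i
    · refine ⟨0, ?_⟩
      rw [Homotopy.dNext_zero_chainComplex, Homotopy.prevD_chainComplex]; simp [hf]
    · refine ⟨hh.hom _ _ ≫ f, ?_⟩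
      rw [Homotopy.dNext_succ_chainComplex, Homotopy.prevD_chainComplex]; simp [hf]
  have h2 : (x ^ t) • y = 0 := (hr.smul _).zero h1
  have hxn : ∀ (n : ℕ) (y : H a i N), x ^ n • y = 0 → y = 0 := by
    intro n
    induction n with
    | zero => intro y hy; simpa using hy
    | succ n ih =>
      intro y hy
      apply ih
      rw [pow_succ', mul_smul] at hy
      have := map_smul' g x i (x ^ n • y)
      rw [hg, ← map_smul, hy, map_zero] at this
      rw [CategoryTheory.Functor.map_id] at this
      exact this
  exact hxn t y h2

end LC

open CategoryTheory Limits Opposite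

namespace LC
variable {R : Type} [CommRing R] {a : Ideal R} {N N' : ModuleCat.{0} R}

abbrev Kil (a : Ideal R) (t : ℕ) (c : N) : Prop := ∀ r ∈ a ^ t, r • c = 0

lemma Kil.mono {s t : ℕ} (h : t ≤ s) {c : N} (hc : Kil a t c) : Kil a s c :=
  fun r hr => hc r (Ideal.pow_le_pow_right h hr)

def pt {t : ℕ} (c : N) (hc : Kil a t c) : ModuleCat.of R (R ⧸ a ^ t) ⟶ N :=
  ModuleCat.ofHom (Submodule.liftQ (a ^ t) (LinearMap.toSpanSingleton R N c) (fun r hr => hc r hr))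

lemma pt_tr {s t : ℕ} (h : t ≤ s) (c : N) (hc : Kil a t c) :
    tr a h ≫ pt c hc = pt c (hc.mono h) := by
  ext
  rfl

lemma pt_map {t : ℕ} (c : N) (hc : Kil a t c) (v : N ⟶ N') (hc' : Kil a t (v c)) :
    pt c hc ≫ v = pt (v c) hc' := by
  ext
  change v ((1:R) • c) = (1:R) • v c
  simp

lemma exists_pt {t : ℕ} (f : ModuleCat.of R (R ⧸ a ^ t) ⟶ N) :
    ∃ c hc, f = pt c hc := by
  have h1 : ∀ r : R, f (Submodule.Quotient.mk r) = r • f (Submodule.Quotient.mk 1) := by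
    intro r
    rw [← map_smul]
    congr 1
    change _ = Submodule.Quotient.mk (r • 1)
    simp
  refine ⟨f (Submodule.Quotient.mk 1), fun r hr => ?_, ?_⟩
  · rw [← h1, (Submodule.Quotient.mk_eq_zero _).2 hr]
    exact map_zero _
  · ext
    exact h1 1

noncomputable abbrev p0 (a : Ideal R) (t : ℕ) :
    (Pt a t).complex.X 0 ⟶ ModuleCat.of R (R ⧸ a ^ t) := (Pt a t).π.f 0

instance (a : Ideal R) (t : ℕ) : Epi (p0 a t) := inferInstanceAs (Epi ((Pt a t).π.f 0))

lemma p0_lift {s t : ℕ} (h : t ≤ s) : (lf a h).f 0 ≫ p0 a t = p0 a s ≫ tr a h :=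
  ProjectiveResolution.lift_commutes_zero _ _ _

lemma Rep0.exists_rep (y : H a 0 N) : ∃ t c, ∃ hc : Kil a t c, Rep a t (p0 a t ≫ pt c hc) y := by
  obtain ⟨t, f, hf, hr⟩ := Rep.exists_rep y
  have he := (Pt a t).exact₀
  have : Epi (ShortComplex.mk _ _ (Pt a t).complex_d_comp_π_f_zero).g :=
    inferInstanceAs (Epi ((Pt a t).π.f 0))
  have h1 : p0 a t ≫ he.desc f hf = f := he.g_desc _ _
  obtain ⟨c, hc, h2⟩ := exists_pt (a := a) (t := t) (he.desc f hf)
  refine ⟨t, c, hc, ?_⟩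
  rw [h2] at h1
  rwa [h1]

lemma Rep0.exists_of {t : ℕ} (c : N) (hc : Kil a t c) : ∃ y, Rep a t (p0 a t ≫ pt c hc) y := by
  refine Rep.exists_of_cocycle _ ?_
  rw [← Category.assoc]
  erw [(Pt a t).complex_d_comp_π_f_zero]
  exact zero_comp

lemma Rep0.lift {s t : ℕ} (h : t ≤ s) (c : N) (hc : Kil a t c) {y}
    (hr : Rep a t (p0 a t ≫ pt c hc) y) : Rep a s (p0 a s ≫ pt c (hc.mono h)) y := by
  have := hr.lift h
  rwa [← Category.assoc, p0_lift, Category.assoc, pt_tr] at this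

lemma Rep0.zero {t : ℕ} (c : N) (hc : Kil a t c) (hr : Rep a t (p0 a t ≫ pt c hc) 0) : c = 0 := by
  obtain ⟨s, hs, g, hg⟩ := hr.of_zero
  rw [← Category.assoc, p0_lift, Category.assoc, pt_tr] at hg
  have : (Pt a s).complex.d 0 (0-1) = 0 := (Pt a s).complex.shape _ _ (by simp)
  rw [this, zero_comp] at hg
  have h2 : pt c (hc.mono hs) = 0 := by
    rw [← cancel_epi (p0 a s), ← hg, comp_zero]
  have h3 : pt c (hc.mono hs) (Submodule.Quotient.mk 1) = 0 := by rw [h2]; rfl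
  change (1:R) • c = 0 at h3
  simpa using h3

lemma Kil.map {t : ℕ} {c : N} (hc : Kil a t c) (v : N ⟶ N') : Kil a t (v c) := by
  intro r hr
  rw [← map_smul, hc r hr, map_zero]

lemma Rep0.map {t : ℕ} (c : N) (hc : Kil a t c) (v : N ⟶ N') {y}
    (hr : Rep a t (p0 a t ≫ pt c hc) y) :
    Rep a t (p0 a t ≫ pt (v c) (hc.map v)) ((localCohomology a 0).map v y) := by
  have := hr.map v
  rwa [Category.assoc, pt_map] at this

lemma surj_zero_iff (v : N ⟶ N') : Function.Surjective ((localCohomology a 0).map v) ↔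
    ∀ c : N', (∃ t, Kil a t c) → ∃ b : N, v b = c ∧ ∃ t, Kil a t b := by
  constructor
  · rintro h c ⟨t, hc⟩
    obtain ⟨y, hy⟩ := Rep0.exists_of c hc
    obtain ⟨y, rfl⟩ := h y
    obtain ⟨t', b, hb, hr⟩ := Rep0.exists_rep y
    refine ⟨b, ?_, t', hb⟩
    have h1 := Rep0.lift (le_max_left t t') _ _ hy
    have h2 := Rep0.lift (le_max_right t t') _ _ (Rep0.map _ _ v hr)
    have h3 := h2.sub h1
    rw [sub_self, ← Preadditive.comp_sub] at h3
    have h4 : pt (v b) ((hb.map v).mono (le_max_right t t')) - pt c (hc.mono (le_max_left t t'))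
      = pt (v b - c) (fun r hr => by
        rw [smul_sub, (hb.map v).mono (le_max_right t t') r hr,
          hc.mono (le_max_left t t') r hr, sub_self]) := by
      ext
      change (1:R) • v b - (1:R) • c = (1:R) • (v b - c)
      simp
    rw [h4] at h3
    exact sub_eq_zero.1 (Rep0.zero _ _ h3)
  · intro h y
    obtain ⟨t, c, hc, hr⟩ := Rep0.exists_rep y
    obtain ⟨b, rfl, t', hb⟩ := h c ⟨t, hc⟩
    obtain ⟨z, hz⟩ := Rep0.exists_of b hb
    have h1 := Rep0.lift (le_max_left t t') _ _ hr
    have h2 := Rep0.lift (le_max_right t t') _ _ (Rep0.map _ _ v hz)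
    exact ⟨z, h2.unique h1⟩

end LC

open CategoryTheory Limits Opposite

namespace LC
variable {R : Type} [CommRing R]

def XT (x : R) (M : Type) [AddCommGroup M] [Module R M] : Prop := ∀ m : M, ∃ k : ℕ, x ^ k • m = 0

lemma XT.of_surj {x : R} {M M' : Type} [AddCommGroup M] [Module R M] [AddCommGroup M'] [Module R M']
    (f : M →ₗ[R] M') (hf : Function.Surjective f) (h : XT x M) : XT x M' := by
  intro m
  obtain ⟨m, rfl⟩ := hf m
  obtain ⟨k, hk⟩ := h m
  exact ⟨k, by rw [← map_smul, hk, map_zero]⟩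

lemma pow_kill_mono {x : R} {M : Type} [AddCommGroup M] [Module R M] {m : M} {k l : ℕ} (h : k ≤ l)
    (hk : x ^ k • m = 0) : x ^ l • m = 0 := by
  obtain ⟨j, rfl⟩ := Nat.exists_eq_add_of_le h
  rw [add_comm, pow_add, mul_smul, hk, smul_zero]

lemma XT.bdd {x : R} {M : Type} [AddCommGroup M] [Module R M] [Module.Finite R M] (h : XT x M) :
    ∃ n : ℕ, ∀ m : M, x ^ n • m = 0 := by
  obtain ⟨S, hS⟩ := (Module.Finite.fg_top : (⊤ : Submodule R M).FG)
  choose k hk using h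
  refine ⟨S.sup k, fun m => ?_⟩
  have hm : m ∈ Submodule.span R (S : Set M) := by rw [hS]; trivial
  induction hm using Submodule.span_induction with
  | mem m hm => exact pow_kill_mono (Finset.le_sup hm) (hk m)
  | zero => simp
  | add a b _ _ ha hb => rw [smul_add, ha, hb, add_zero]
  | smul r a _ ha => rw [smul_comm, ha, smul_zero]

abbrev Tor (x : R) (J : Type) [AddCommGroup J] [Module R J] : Submodule R J :=
  Submodule.torsion' R J (Submonoid.powers x)

lemma mem_Tor {x : R} {J : Type} [AddCommGroup J] [Module R J] {m : J} :
    m ∈ Tor x J ↔ ∃ k : ℕ, x ^ k • m = 0 := by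
  rw [Submodule.mem_torsion'_iff]
  constructor
  · rintro ⟨⟨_, k, rfl⟩, h⟩; exact ⟨k, h⟩
  · rintro ⟨k, h⟩; exact ⟨⟨_, k, rfl⟩, h⟩

lemma XT_Tor (x : R) (J : Type) [AddCommGroup J] [Module R J] : XT x (Tor x J) := by
  rintro ⟨m, hm⟩
  obtain ⟨k, hk⟩ := mem_Tor.1 hm
  exact ⟨k, Subtype.ext hk⟩

lemma Tor_injective [IsNoetherianRing R] (x : R) (J : Type) [AddCommGroup J] [Module R J]
    [Module.Injective R J] : Module.Injective R (Tor x J) := by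
  apply Module.Baer.injective
  intro I g
  obtain ⟨n, hn⟩ : ∃ n : ℕ, ∀ y : I, x ^ n • g y = 0 := by
    have h1 : XT x (LinearMap.range g) := by
      rintro ⟨m, hm⟩
      obtain ⟨k, hk⟩ := XT_Tor x J m
      exact ⟨k, Subtype.ext hk⟩
    obtain ⟨n, hn⟩ := h1.bdd
    exact ⟨n, fun y => congrArg Subtype.val (hn ⟨g y, y, rfl⟩)⟩
  obtain ⟨k, hk⟩ := Ideal.exists_pow_inf_eq_pow_smul (Ideal.span {x}) (M := R) I
  have hk := hk (k + n) (by omega)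
  rw [Nat.add_sub_cancel_left] at hk
  let q : I →ₗ[R] R ⧸ (Ideal.span {x} ^ (k + n)) := (Submodule.mkQ _).comp I.subtype
  have hker : LinearMap.ker q ≤ LinearMap.ker g := by
    intro z hz
    have hz1 : (z : R) ∈ Ideal.span {x} ^ (k + n) := by
      have : Submodule.Quotient.mk (z : R) = (0 : R ⧸ (Ideal.span {x} ^ (k + n))) := hz
      rwa [Submodule.Quotient.mk_eq_zero] at this
    have hz2 : (z : R) ∈ (Ideal.span {x} ^ (k + n) • ⊤ ⊓ I : Submodule R R) :=
      ⟨by simpa using hz1, z.2⟩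
    rw [hk, Ideal.span_singleton_pow, Submodule.ideal_span_singleton_smul,
      Submodule.mem_smul_pointwise_iff_exists] at hz2
    obtain ⟨w, hw, hwz⟩ := hz2
    have : z = x ^ n • (⟨w, hw.2⟩ : I) := Subtype.ext hwz.symm
    rw [LinearMap.mem_ker, this, map_smul, hn]
  let g1 : (I ⧸ LinearMap.ker q) →ₗ[R] J :=
    Submodule.liftQ _ ((Tor x J).subtype.comp g) (fun z hz => by
      have := hker hz
      rw [LinearMap.mem_ker] at this
      simp [this])
  obtain ⟨h, hh⟩ := Module.Injective.out ((LinearMap.ker q).liftQ q le_rfl)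
    (LinearMap.ker_eq_bot.1 (Submodule.ker_liftQ_eq_bot _ _ _ le_rfl)) g1
  refine ⟨LinearMap.codRestrict _ (h.comp (Submodule.mkQ _)) ?_, ?_⟩
  · intro r
    rw [mem_Tor]
    refine ⟨k + n, ?_⟩
    rw [← map_smul, LinearMap.comp_apply, Submodule.mkQ_apply,
      (Submodule.Quotient.mk_eq_zero _).2, map_zero]
    rw [smul_eq_mul]
    exact Ideal.mul_mem_right _ _ (Ideal.pow_mem_pow (Ideal.mem_span_singleton_self x) _)
  · intro y hy
    apply Subtype.ext
    have := hh (Submodule.Quotient.mk ⟨y, hy⟩)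
    exact this

lemma ses_of_sub {N : Type} [AddCommGroup N] [Module R N] (K : Submodule R N) :
    Ses (ModuleCat.ofHom K.subtype) (ModuleCat.ofHom K.mkQ) :=
  Ses.mk' _ _ K.injective_subtype K.mkQ_surjective
    (LinearMap.exact_subtype_mkQ K)

lemma ses_of_inj {N N' : Type} [AddCommGroup N] [Module R N] [AddCommGroup N'] [Module R N']
    (f : N →ₗ[R] N') (hf : Function.Injective f) :
    Ses (ModuleCat.ofHom f) (ModuleCat.ofHom (LinearMap.range f).mkQ) :=
  Ses.mk' _ _ hf (Submodule.mkQ_surjective _)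
    (LinearMap.exact_map_mkQ_range f)

lemma ses_of_surj {N N' : Type} [AddCommGroup N] [Module R N] [AddCommGroup N'] [Module R N']
    (f : N →ₗ[R] N') (hf : Function.Surjective f) :
    Ses (ModuleCat.ofHom (LinearMap.ker f).subtype) (ModuleCat.ofHom f) :=
  Ses.mk' _ _ (Submodule.injective_subtype _) hf
    (LinearMap.exact_subtype_ker_map f)

lemma exists_inj (N : Type) [AddCommGroup N] [Module R N] :
    ∃ (J : Type) (_ : AddCommGroup J) (_ : Module R J) (_ : Module.Injective R J) (f : N →ₗ[R] J),
      Function.Injective f := by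
  let M := ModuleCat.of R N
  let J : ModuleCat R := Injective.under M
  refine ⟨J, inferInstance, inferInstance, ?_, (Injective.ι M).hom, ?_⟩
  · have : Injective (ModuleCat.of R J) := inferInstanceAs (Injective (Injective.under M))
    exact Module.injective_module_of_injective_object R J
  · exact (ModuleCat.mono_iff_injective (Injective.ι M)).1 inferInstance

lemma exists_inj_XT [IsNoetherianRing R] (x : R) (N : Type) [AddCommGroup N] [Module R N]
    (h : XT x N) :
    ∃ (J : Type) (_ : AddCommGroup J) (_ : Module R J) (_ : Module.Injective R J) (f : N →ₗ[R] J),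
      Function.Injective f ∧ XT x J := by
  obtain ⟨J, _, _, _, f, hf⟩ := exists_inj (R := R) N
  refine ⟨Tor x J, inferInstance, inferInstance, Tor_injective x J, LinearMap.codRestrict _ f ?_,
    ?_, XT_Tor x J⟩
  · intro n
    obtain ⟨k, hk⟩ := h n
    exact mem_Tor.2 ⟨k, by rw [← map_smul, hk, map_zero]⟩
  · intro m m' h
    exact hf (congrArg Subtype.val h)

abbrev Van (a : Ideal R) (i : ℕ) (N : Type) [AddCommGroup N] [Module R N] : Prop :=
  Subsingleton (H a i (ModuleCat.of R N))

lemma Van.inj (a : Ideal R) (i : ℕ) (N : Type) [AddCommGroup N] [Module R N] [Module.Injective R N] :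
    Van a (i+1) N := by
  have : Injective (ModuleCat.of R N) := (Module.injective_iff_injective_object R N).1 inferInstance
  exact van_inj _ i

lemma compare [IsNoetherianRing R] (a : Ideal R) (x : R) (i : ℕ) :
    ∀ (N : Type) [AddCommGroup N] [Module R N], XT x N → Van a (i+1) N →
      Van (a ⊔ Ideal.span {x}) (i+1) N := by
  induction i with
  | zero =>
    intro N _ _ hN hv
    obtain ⟨J, _, _, _, f, hf, hJ⟩ := exists_inj_XT x N hN
    have hS := ses_of_inj f hf
    refine van_left hS 0 ?_ (Van.inj _ _ _)
    have h1 := surj_of hS 0 hv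
    rw [surj_zero_iff] at h1 ⊢
    rintro c ⟨t, hc⟩
    obtain ⟨b, hb, s, hs⟩ := h1 c ⟨t, fun r hr => hc r (Ideal.pow_right_mono le_sup_left _ hr)⟩
    obtain ⟨k, hk⟩ := hJ b
    refine ⟨b, hb, s + k, fun r hr => ?_⟩
    obtain ⟨r1, h1, r2, h2, rfl⟩ := Submodule.mem_sup.1 (Ideal.sup_pow_add_le_pow_sup_pow hr)
    rw [Ideal.span_singleton_pow, Ideal.mem_span_singleton'] at h2
    obtain ⟨r2, rfl⟩ := h2
    rw [add_smul, hs r1 h1, mul_smul]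
    erw [hk]
    simp
  | succ i ih =>
    intro N _ _ hN hv
    obtain ⟨J, _, _, _, f, hf, hJ⟩ := exists_inj_XT x N hN
    have hS := ses_of_inj f hf
    have h1 := ih _ (hJ.of_surj (LinearMap.range f).mkQ (Submodule.mkQ_surjective _))
      (van_right hS _ hv (Van.inj _ _ _))
    refine van_left hS (i+1) ?_ (Van.inj _ _ _)
    intro y
    exact ⟨0, h1.elim _ _⟩

lemma van_bot (i : ℕ) :
    ∀ (N : Type) [AddCommGroup N] [Module R N], Van (⊥ : Ideal R) (i+1) N := by
  induction i with
  | zero =>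
    intro N _ _
    obtain ⟨J, _, _, _, f, hf⟩ := exists_inj (R := R) N
    have hS := ses_of_inj f hf
    refine van_left hS 0 ?_ (Van.inj _ _ _)
    rw [surj_zero_iff]
    rintro c -
    obtain ⟨b, hb⟩ := Submodule.mkQ_surjective _ c
    exact ⟨b, hb, 1, fun r hr => by
      rw [pow_one, Ideal.mem_bot] at hr
      rw [hr, zero_smul]⟩
  | succ i ih =>
    intro N _ _
    obtain ⟨J, _, _, _, f, hf⟩ := exists_inj (R := R) N
    have hS := ses_of_inj f hf
    refine van_left hS (i+1) ?_ (Van.inj _ _ _)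
    intro y
    exact ⟨0, (ih _).elim _ _⟩

lemma van_step [IsNoetherianRing R] (a : Ideal R) (x : R) (d : ℕ)
    (hd : ∀ (N : Type) [AddCommGroup N] [Module R N], ∀ i, d < i → Van a i N) :
    ∀ (N : Type) [AddCommGroup N] [Module R N], ∀ i, d + 1 < i →
      Van (a ⊔ Ideal.span {x}) i N := by
  intro N _ _ i hi
  obtain ⟨j, rfl⟩ : ∃ j, i = j + 1 + 1 := ⟨i - 2, by omega⟩
  have hxt : ∀ (N : Type) [AddCommGroup N] [Module R N], XT x N → ∀ i, d < i →
      Van (a ⊔ Ideal.span {x}) i N := by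
    intro N _ _ hN i hi
    obtain ⟨j, rfl⟩ : ∃ j, i = j + 1 := ⟨i - 1, by omega⟩
    exact compare a x j N hN (hd N _ hi)
  let f := LocalizedModule.mkLinearMap (Submonoid.powers x) N
  have hL : ∀ i, Van (a ⊔ Ideal.span {x}) i (LocalizedModule (Submonoid.powers x) N) := by
    intro i
    refine van_of_inv _ x (Ideal.mem_sup_right (Ideal.mem_span_singleton_self x))
      (ModuleCat.ofHom (LocalizedModule.divBy ⟨x, Submonoid.mem_powers x⟩)) ?_ i
    ext p
    exact LocalizedModule.mul_by_divBy (⟨x, Submonoid.mem_powers x⟩ : Submonoid.powers x) p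
  have h1 : XT x (LinearMap.ker f) := by
    rintro ⟨m, hm⟩
    obtain ⟨⟨_, k, rfl⟩, hc⟩ := (IsLocalizedModule.eq_zero_iff (Submonoid.powers x) f).1 hm
    exact ⟨k, Subtype.ext hc⟩
  have h2 : XT x (LocalizedModule (Submonoid.powers x) N ⧸ LinearMap.range f) := by
    intro m
    obtain ⟨m, rfl⟩ := Submodule.mkQ_surjective _ m
    obtain ⟨⟨n, ⟨_, k, rfl⟩⟩, hc⟩ := IsLocalizedModule.surj (Submonoid.powers x) f m
    refine ⟨k, ?_⟩
    rw [← map_smul, Submodule.mkQ_apply, Submodule.Quotient.mk_eq_zero]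
    exact ⟨n, hc.symm⟩
  have h3 : Van (a ⊔ Ideal.span {x}) (j+1+1) (LinearMap.range f) := by
    refine van_left (ses_of_sub (LinearMap.range f)) (j+1) ?_ (hL _)
    intro y
    exact ⟨0, (hxt _ h2 (j+1) (by omega)).elim _ _⟩
  have hS : Ses (ModuleCat.ofHom (LinearMap.ker f).subtype) (ModuleCat.ofHom f.rangeRestrict) :=
    Ses.mk' _ _ (Submodule.injective_subtype _) f.surjective_rangeRestrict (by
      intro y
      constructor
      · intro hy
        exact ⟨⟨y, congrArg Subtype.val hy⟩, rfl⟩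
      · rintro ⟨y, rfl⟩
        exact Subtype.ext y.2)
  exact van_mid hS _ (hxt _ h1 _ (by omega)) h3

lemma van_large [IsNoetherianRing R] (a : Ideal R) :
    ∃ d, ∀ (N : Type) [AddCommGroup N] [Module R N], ∀ i, d < i → Van a i N := by
  classical
  obtain ⟨S, rfl⟩ := (isNoetherianRing_iff_ideal_fg R).1 inferInstance a
  induction S using Finset.induction_on with
  | empty =>
    refine ⟨0, fun N _ _ i hi => ?_⟩
    obtain ⟨j, rfl⟩ : ∃ j, i = j + 1 := ⟨i - 1, by omega⟩
    have := van_bot (R := R) j N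
    simpa using this
  | insert x S _ ih =>
    obtain ⟨d, hd⟩ := ih
    refine ⟨d + 1, ?_⟩
    have := van_step _ x d hd
    rw [Finset.coe_insert, Ideal.span_insert, sup_comm]
    exact this

end LC

open CategoryTheory Limits Opposite

namespace LC
variable {R : Type} [CommRing R]

lemma van_zero (a : Ideal R) (i : ℕ) (N : Type) [AddCommGroup N] [Module R N] [Subsingleton N] :
    Van a i N := by
  refine subsingleton_of_forall_eq 0 fun y => ?_
  have h := map_smul' (𝟙 (ModuleCat.of R N)) (0 : R) i y
  have h2 : (0 : R) • 𝟙 (ModuleCat.of R N) = 𝟙 (ModuleCat.of R N) := by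
    ext x
    exact Subsingleton.elim (α := N) _ _
  rw [h2, zero_smul, CategoryTheory.Functor.map_id] at h
  exact h

lemma filt [IsNoetherianRing R] (a : Ideal R) (i : ℕ) (S : Set (PrimeSpectrum R))
    (hS : ∀ p ∈ S, Van a i (R ⧸ p.asIdeal)) (N : Type) [AddCommGroup N] [Module R N]
    (hN : Module.Finite R N) (hs : Module.support R N ⊆ S) : Van a i N := by
  revert hs
  induction hN using IsNoetherianRing.induction_on_isQuotientEquivQuotientPrime R with
  | subsingleton N => intro _; exact van_zero a i N
  | quotient N p e =>
    intro hs
    have hp : p ∈ Module.support R N := by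
      rw [e.support_eq, Module.mem_support_iff_of_finite, Ideal.annihilator_quotient]
    exact van_iso e.symm.toModuleIso i (hS p (hs hp))
  | exact N₁ N₂ N₃ f g hf hg hfg h₁ h₃ =>
    intro hs
    exact van_mid (Ses.mk' (ModuleCat.ofHom f) (ModuleCat.ofHom g) hf hg hfg) i
      (h₁ ((Module.support_subset_of_injective f hf).trans hs))
      (h₃ ((Module.support_subset_of_surjective g hg).trans hs))

open TensorProduct in
lemma exists_nonzero (M : Type) [AddCommGroup M] [Module R M] [Module.Finite R M]
    (p : PrimeSpectrum R) (hp : p ∈ Module.support R M) :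
    ∃ h : M →ₗ[R] R ⧸ p.asIdeal, h ≠ 0 := by
  classical
  rw [Module.mem_support_iff_nontrivial_residueField_tensorProduct] at hp
  let K := p.asIdeal.ResidueField
  obtain ⟨x, hx⟩ := exists_ne (0 : K ⊗[R] M)
  obtain ⟨φ, hφ⟩ : ∃ φ : Module.Dual K (K ⊗[R] M), φ x ≠ 0 := by
    by_contra hc
    push Not at hc
    exact hx ((Module.forall_dual_apply_eq_zero_iff K x).1 hc)
  let ψ : M →ₗ[R] K := (φ.restrictScalars R).comp (TensorProduct.mk R K M 1)
  have hψ : ∃ m, ψ m ≠ 0 := by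
    by_contra hc
    push Not at hc
    apply hφ
    induction x using TensorProduct.induction_on with
    | zero => exact map_zero _
    | tmul c m =>
      have h1 : c ⊗ₜ[R] m = c • ((1 : K) ⊗ₜ[R] m) := by
        rw [TensorProduct.smul_tmul', smul_eq_mul, mul_one]
      have h2 : φ ((1 : K) ⊗ₜ[R] m) = 0 := hc m
      rw [h1, map_smul, h2, smul_zero]
    | add u v hu hv =>
      have h1 : ∀ z : K ⊗[R] M, φ z = 0 := by
        intro z
        induction z using TensorProduct.induction_on with
        | zero => exact map_zero _
        | tmul c m =>
          have h1 : c ⊗ₜ[R] m = c • ((1 : K) ⊗ₜ[R] m) := by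
            rw [TensorProduct.smul_tmul', smul_eq_mul, mul_one]
          have h2 : φ ((1 : K) ⊗ₜ[R] m) = 0 := hc m
          rw [h1, map_smul, h2, smul_zero]
        | add u v hu hv => rw [map_add, hu, hv, add_zero]
      exact h1 _
  obtain ⟨s, hs⟩ := Module.finite_def.1 (inferInstance : Module.Finite R M)
  obtain ⟨b, hb⟩ := IsLocalization.exist_integer_multiples_of_finset
    (nonZeroDivisors (R ⧸ p.asIdeal)) (s.image ψ)
  let c : K := algebraMap (R ⧸ p.asIdeal) K b
  have hc : c ≠ 0 := IsFractionRing.to_map_ne_zero_of_mem_nonZeroDivisors b.2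
  let ι : (R ⧸ p.asIdeal) →ₗ[R] K := (IsScalarTower.toAlgHom R (R ⧸ p.asIdeal) K).toLinearMap
  have hι : Function.Injective ι := IsFractionRing.injective (R ⧸ p.asIdeal) K
  let θ : M →ₗ[R] K := (LinearMap.mulLeft R c).comp ψ
  have hθ : ∀ m, θ m ∈ LinearMap.range ι := by
    have : (⊤ : Submodule R M) ≤ (LinearMap.range ι).comap θ := by
      rw [← hs, Submodule.span_le]
      intro m hm
      obtain ⟨y, hy⟩ := hb (ψ m) (Finset.mem_image_of_mem _ hm)
      refine ⟨y, hy.trans ?_⟩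
      change (b : R ⧸ p.asIdeal) • ψ m = c * ψ m
      rw [Algebra.smul_def]
    exact fun m => this trivial
  obtain ⟨m, hm⟩ := hψ
  refine ⟨(LinearEquiv.ofInjective ι hι).symm.toLinearMap.comp (θ.codRestrict _ hθ), fun h => ?_⟩
  have h1 := LinearMap.congr_fun h m
  have h2 : (LinearEquiv.ofInjective ι hι).symm (θ.codRestrict _ hθ m) = 0 := h1
  rw [LinearEquiv.map_eq_zero_iff] at h2
  have h3 : θ m = 0 := congrArg Subtype.val h2
  exact mul_ne_zero hc hm h3

lemma van_primes [IsNoetherianRing R] (a : Ideal R) (i : ℕ) (M : Type) [AddCommGroup M]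
    [Module R M] [Module.Finite R M]
    (hup : ∀ (N : Type) [AddCommGroup N] [Module R N] [Module.Finite R N],
      Module.support R N ⊆ Module.support R M → Van a (i+1) N)
    (hM : Van a i M) (p : PrimeSpectrum R) :
    p ∈ Module.support R M → Van a i (R ⧸ p.asIdeal) := by
  have : WellFoundedGT (PrimeSpectrum R) :=
    ⟨Subrelation.wf (fun h => h) (InvImage.wf PrimeSpectrum.asIdeal
      (wellFounded_gt : WellFounded ((· > ·) : Ideal R → Ideal R → Prop)))⟩
  induction p using WellFoundedGT.induction with
  | ind p ih =>
  intro hp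
  obtain ⟨h, hh⟩ := exists_nonzero M p hp
  have hker : Module.support R (LinearMap.ker h) ⊆ Module.support R M :=
    Module.support_subset_of_injective _ (Submodule.injective_subtype _)
  have h1 : Van a i (LinearMap.range h) := by
    have hS : Ses (ModuleCat.ofHom (LinearMap.ker h).subtype) (ModuleCat.ofHom h.rangeRestrict) :=
      Ses.mk' _ _ (Submodule.injective_subtype _) h.surjective_rangeRestrict (by
        intro y
        constructor
        · intro hy
          exact ⟨⟨y, congrArg Subtype.val hy⟩, rfl⟩
        · rintro ⟨y, rfl⟩
          exact Subtype.ext y.2)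
    exact van_right hS i (hup _ hker) hM
  have h2 : Van a i ((R ⧸ p.asIdeal) ⧸ LinearMap.range h) := by
    refine filt a i {q | p < q} (fun q hq => ih q hq (Module.mem_support_mono (le_of_lt hq) hp)) _
      inferInstance ?_
    intro q hq
    rw [Module.mem_support_iff_of_finite] at hq
    obtain ⟨m, hm⟩ : ∃ m, h m ≠ 0 := by
      by_contra hc
      push Not at hc
      exact hh (LinearMap.ext hc)
    obtain ⟨r, hr⟩ := Ideal.Quotient.mk_surjective (h m)
    have hrp : r ∉ p.asIdeal := by
      intro hc
      exact hm (by rw [← hr]; exact Ideal.Quotient.eq_zero_iff_mem.2 hc)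
    have hrq : r ∈ q.asIdeal := by
      apply hq
      rw [Module.mem_annihilator]
      intro y
      obtain ⟨y, rfl⟩ := Submodule.Quotient.mk_surjective _ y
      obtain ⟨y, rfl⟩ := Ideal.Quotient.mk_surjective y
      rw [← Submodule.Quotient.mk_smul, Submodule.Quotient.mk_eq_zero]
      refine ⟨y • m, ?_⟩
      rw [map_smul, ← hr, Algebra.smul_def, Algebra.smul_def, mul_comm]
      rfl
    have hle : p ≤ q := by
      intro s hs
      apply hq
      rw [Module.mem_annihilator]
      intro y
      obtain ⟨y, rfl⟩ := Submodule.Quotient.mk_surjective _ y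
      rw [← Submodule.Quotient.mk_smul, Algebra.smul_def]
      have : algebraMap R (R ⧸ p.asIdeal) s = 0 := Ideal.Quotient.eq_zero_iff_mem.2 hs
      rw [this, zero_mul, Submodule.Quotient.mk_zero]
    refine lt_of_le_of_ne hle ?_
    rintro rfl
    exact hrp hrq
  exact van_mid (ses_of_sub (LinearMap.range h)) i h1 h2

lemma vanAll [IsNoetherianRing R] (a : Ideal R) (n : ℕ) (M : Type) [AddCommGroup M]
    [Module R M] [Module.Finite R M] (hM : ∀ i, n < i → Van a i M) (i : ℕ) (hi : n < i)
    (N : Type) [AddCommGroup N] [Module R N] [Module.Finite R N]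
    (hN : Module.support R N ⊆ Module.support R M) : Van a i N := by
  obtain ⟨d, hd⟩ := van_large a
  suffices H : ∀ k i, n < i → d < i + k → ∀ (N : Type) [AddCommGroup N] [Module R N]
      [Module.Finite R N], Module.support R N ⊆ Module.support R M → Van a i N from
    H (d + 1) i hi (by omega) N hN
  intro k
  induction k with
  | zero => intro i _ h N _ _ _ _; exact hd N i h
  | succ k ih =>
    intro i hi h N _ _ hfin hN
    exact filt a i _ (van_primes a i M (ih (i+1) (by omega) (by omega)) (hM i hi)) N hfin hN

end LC

theorem stmt5 {R : Type} [CommRing R] [IsNoetherianRing R]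
    (a : Ideal R) (M : ModuleCat R) [Module.Finite R M]
    (n : ℕ) (hcd : HasCD a M n) :
    IsGreatest
      {I : Ideal R | Nonempty ((localCohomology a n).obj M ≅
        (localCohomology a n).obj (ModuleCat.of R (M ⧸ (I • ⊤ : Submodule R M))))}
      (Module.annihilator R ((localCohomology a n).obj M)) := by
  have hall := LC.vanAll a n M hcd.2
  constructor
  · generalize hI : Module.annihilator R ((localCohomology a n).obj M) = I
    obtain ⟨S, hS⟩ := (isNoetherianRing_iff_ideal_fg R).1 inferInstance I
    let K : Submodule R M := I • ⊤
    have hses := LC.ses_of_sub K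
    have hsurj := LC.surj_of (a := a) hses n (hall (n+1) (by omega) K
      (Module.support_subset_of_injective _ K.injective_subtype))
    have hSI : ∀ s ∈ S, s ∈ I := fun s hs => hS ▸ Ideal.subset_span hs
    have hmem : ∀ m : (S → M), (∑ s : S, (s : R) • LinearMap.proj (R := R) (φ := fun _ : S => M) s) m ∈ K := by
      intro m
      simp only [LinearMap.sum_apply, LinearMap.smul_apply, LinearMap.proj_apply]
      exact Submodule.sum_mem _ fun s _ => Submodule.smul_mem_smul (hSI _ s.2) trivial
    let w : (S → M) →ₗ[R] K := LinearMap.codRestrict K _ hmem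
    have hw : Function.Surjective w := by
      classical
      have : K ≤ LinearMap.range (∑ s : S, (s : R) • LinearMap.proj (R := R) (φ := fun _ : S => M) s) := by
        have h0 : K = Ideal.span (S : Set R) • ⊤ := by rw [hS]
        rw [h0, Submodule.smul_le]
        intro r hr m _
        induction hr using Submodule.span_induction with
        | mem x hx =>
          refine ⟨Pi.single ⟨x, hx⟩ m, ?_⟩
          simp only [LinearMap.sum_apply, LinearMap.smul_apply, LinearMap.proj_apply]
          rw [Finset.sum_eq_single ⟨x, hx⟩]
          · rw [Pi.single_eq_same]
          · intro t _ ht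
            rw [Pi.single_eq_of_ne ht, smul_zero]
          · exact fun h => absurd (Finset.mem_univ _) h
        | zero => rw [zero_smul]; exact Submodule.zero_mem _
        | add x y _ _ hx hy => rw [add_smul]; exact Submodule.add_mem _ hx hy
        | smul c x _ hx => rw [smul_assoc]; exact Submodule.smul_mem _ _ hx
      rintro ⟨k, hk⟩
      obtain ⟨m, hm⟩ := this hk
      exact ⟨m, Subtype.ext hm⟩
    have hwS := LC.surj_of (a := a) (LC.ses_of_surj w hw) n (hall (n+1) (by omega) (LinearMap.ker w) (by
      intro q hq
      have hq := Module.support_subset_of_injective _ (LinearMap.ker w).injective_subtype hq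
      rw [Module.mem_support_iff_of_finite] at hq ⊢
      refine le_trans ?_ hq
      intro r hr
      rw [Module.mem_annihilator] at hr ⊢
      intro m
      ext s
      exact hr _))
    have hinj : Function.Injective ((localCohomology a n).map (ModuleCat.ofHom K.mkQ)) := by
      rw [injective_iff_map_eq_zero]
      intro y hy
      obtain ⟨z, rfl⟩ := LC.mid_exact hses n y hy
      obtain ⟨z, rfl⟩ := hwS z
      have key : ∀ T : Finset S, (localCohomology a n).map (ModuleCat.ofHom
          (∑ s ∈ T, (s : R) • LinearMap.proj (R := R) (φ := fun _ : S => M) s)) z = 0 := by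
        classical
        intro T
        induction T using Finset.induction_on with
        | empty =>
          have := LC.map_smul' (ModuleCat.ofHom (0 : (S → M) →ₗ[R] M)) (0 : R) n z
          rw [zero_smul, zero_smul] at this
          rw [Finset.sum_empty]
          exact this
        | insert s T hs ih =>
          rw [Finset.sum_insert hs, ModuleCat.ofHom_add]
          refine (LC.map_add' _ _ n z).trans ?_
          rw [ih, add_zero]
          refine (LC.map_smul' (ModuleCat.ofHom (LinearMap.proj (R := R) (φ := fun _ : S => M) s)) (s : R) n z).trans ?_
          have h := hSI _ s.2
          rw [← hI, Module.mem_annihilator] at h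
          exact h _
      have h2 := key Finset.univ
      rw [← ModuleCat.comp_apply, ← CategoryTheory.Functor.map_comp]
      exact h2
    exact ⟨(LinearEquiv.ofBijective ((localCohomology a n).map (ModuleCat.ofHom K.mkQ)).hom ⟨hinj, hsurj⟩).toModuleIso⟩
  · rintro I ⟨e⟩ r hr
    rw [Module.mem_annihilator]
    intro y
    apply e.toLinearEquiv.injective
    rw [map_smul, map_zero]
    generalize e.toLinearEquiv y = y'
    have h := LC.map_smul' (𝟙 (ModuleCat.of R (M ⧸ (I • ⊤ : Submodule R M)))) r n y'
    rw [CategoryTheory.Functor.map_id] at h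
    refine h.symm.trans ?_
    have h2 : r • 𝟙 (ModuleCat.of R (M ⧸ (I • ⊤ : Submodule R M))) =
        (0 : R) • 𝟙 (ModuleCat.of R (M ⧸ (I • ⊤ : Submodule R M))) := by
      refine ModuleCat.hom_ext (LinearMap.ext fun x => ?_)
      obtain ⟨x, rfl⟩ := Submodule.Quotient.mk_surjective _ x
      change r • (Submodule.Quotient.mk x : M ⧸ (I • ⊤ : Submodule R M)) =
        (0 : R) • (Submodule.Quotient.mk x : M ⧸ (I • ⊤ : Submodule R M))
      rw [zero_smul, ← Submodule.Quotient.mk_smul, Submodule.Quotient.mk_eq_zero]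
      exact Submodule.smul_mem_smul hr trivial
    rw [h2, LC.map_smul', zero_smul]
end

section
/- Let (R, 𝔪) be a Noetherian local ring, 𝔞 an ideal, and M a nonzero finitely generated R-module with g := grade(𝔞, M) and c := cd(𝔞, M). Then (Ann_R H^g_𝔞(M)) (Ann_R H^{g+1}_𝔞(M)) ⋯ (Ann_R H^c_𝔞(M)) ⊆ Ann_R M. -/
open CategoryTheory

namespace AnnLC

variable {R : Type} [CommRing R]

lemma extend_of_ker_le {A B Q : Type} [AddCommGroup A] [Module R A] [AddCommGroup B] [Module R B]
    [AddCommGroup Q] [Module R Q] (hQ : Module.Injective R Q) (p : A →ₗ[R] B) (g : A →ₗ[R] Q)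
    (h : ∀ a, p a = 0 → g a = 0) : ∃ k : B →ₗ[R] Q, ∀ a, k (p a) = g a := by
  have hker : LinearMap.ker p ≤ LinearMap.ker g := fun a ha => h a ha
  obtain ⟨k, hk⟩ := hQ.out ((LinearMap.ker p).liftQ p le_rfl)
    (LinearMap.ker_eq_bot.1 (Submodule.ker_liftQ_eq_bot _ _ _ le_rfl))
    ((LinearMap.ker p).liftQ g hker)
  exact ⟨k, fun a => by simpa using hk (Submodule.Quotient.mk a)⟩

lemma divis [IsNoetherianRing R] {E : Type} [AddCommGroup E] [Module R E]
    (hE : Module.Injective R E) (Y : R) (e : E) :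
    ∃ e' : E, (∀ r : R, r • e = 0 → r • e' = 0) ∧ ∃ k : ℕ, Y ^ k • (e - Y • e') = 0 := by
  let f : ℕ →o Ideal R :=
    ⟨fun k => LinearMap.ker (LinearMap.toSpanSingleton R E (Y ^ k • e)), by
      refine monotone_nat_of_le_succ fun k r hr => ?_
      simp only [LinearMap.mem_ker, LinearMap.toSpanSingleton_apply] at hr ⊢
      rw [pow_succ', mul_smul, smul_comm, hr, smul_zero]⟩
  obtain ⟨k, hk⟩ := monotone_stabilizes_iff_noetherian.2 (inferInstance : IsNoetherian R R) f
  have hk1 : f k = f (k + 1) := hk (k + 1) (by omega)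
  let N := Submodule.span R {e}
  let e0 : N := ⟨e, Submodule.mem_span_singleton_self e⟩
  obtain ⟨h, hh⟩ := extend_of_ker_le hE (LinearMap.toSpanSingleton R N (Y ^ (k+1) • e0))
    (LinearMap.toSpanSingleton R E (Y ^ k • e)) (by
      intro r hr
      have : r ∈ f (k+1) := by
        have := congrArg (Subtype.val) hr
        simpa [f] using this
      rw [← hk1] at this
      simpa [f] using this)
  refine ⟨h e0, fun r hr => ?_, k, ?_⟩
  · rw [← map_smul]
    have : r • e0 = 0 := Subtype.ext hr
    rw [this, map_zero]
  · have := hh 1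
    simp only [LinearMap.toSpanSingleton_apply, one_smul, map_smul] at this
    rw [smul_sub, ← this, pow_succ, mul_smul, sub_self]

/-- elements killed by a power of each member of `s`. -/
def tors (s : Finset R) (E : Type) [AddCommGroup E] [Module R E] : Submodule R E where
  carrier := {e | ∀ y ∈ s, ∃ k : ℕ, y ^ k • e = 0}
  zero_mem' := fun y _ => ⟨0, by simp⟩
  add_mem' := by
    intro u v hu hv y hy
    obtain ⟨k, hk⟩ := hu y hy
    obtain ⟨l, hl⟩ := hv y hy
    refine ⟨k + l, ?_⟩
    rw [smul_add, pow_add, mul_smul, mul_smul, hl, smul_comm, hk]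
    simp
  smul_mem' := by
    intro r u hu y hy
    obtain ⟨k, hk⟩ := hu y hy
    exact ⟨k, by rw [smul_comm, hk, smul_zero]⟩

lemma mem_tors {s : Finset R} {E : Type} [AddCommGroup E] [Module R E] {e : E} :
    e ∈ tors s E ↔ ∀ y ∈ s, ∃ k : ℕ, y ^ k • e = 0 := Iff.rfl

lemma map_tors {s : Finset R} {E F : Type} [AddCommGroup E] [Module R E] [AddCommGroup F]
    [Module R F] (f : E →ₗ[R] F) {e : E} (he : e ∈ tors s E) : f e ∈ tors s F := by
  intro y hy
  obtain ⟨k, hk⟩ := he y hy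
  exact ⟨k, by rw [← map_smul, hk, map_zero]⟩

lemma mem_tors_iff_pow [IsNoetherianRing R] {s : Finset R} {E : Type} [AddCommGroup E] [Module R E]
    {e : E} : e ∈ tors s E ↔ ∃ n : ℕ, ∀ r ∈ (Ideal.span (s : Set R)) ^ n, r • e = 0 := by
  constructor
  · intro he
    let J : Ideal R := LinearMap.ker (LinearMap.toSpanSingleton R E e)
    have h1 : Ideal.span (s : Set R) ≤ J.radical := by
      rw [Ideal.span_le]
      intro y hy
      obtain ⟨k, hk⟩ := he y hy
      exact ⟨k, by simpa [J] using hk⟩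
    obtain ⟨n, hn⟩ := Ideal.exists_pow_le_of_le_radical_of_fg h1 ((isNoetherianRing_iff_ideal_fg R).1 inferInstance _)
    exact ⟨n, fun r hr => by simpa [J] using hn hr⟩
  · rintro ⟨n, hn⟩ y hy
    exact ⟨n, hn _ (Ideal.pow_mem_pow (Ideal.subset_span hy) n)⟩

section cplx

variable {I Q : ℕ → Type} [∀ q, AddCommGroup (I q)] [∀ q, Module R (I q)]
  [∀ q, AddCommGroup (Q q)] [∀ q, Module R (Q q)]
  (dI : ∀ q, I q →ₗ[R] I (q + 1)) (dQ : ∀ q, Q q →ₗ[R] Q (q + 1))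

/-- chain maps -/
def IsChain (f : ∀ q, I q →ₗ[R] Q q) : Prop := ∀ q e, f (q + 1) (dI q e) = dQ q (f q e)

/-- modification of a chain map by a homotopy -/
def modif (f : ∀ q, I q →ₗ[R] Q q) (h : ∀ q, I (q + 1) →ₗ[R] Q q) : ∀ q, I q →ₗ[R] Q q
  | 0 => f 0 - h 0 ∘ₗ dI 0
  | q + 1 => f (q + 1) - dQ q ∘ₗ h q - h (q + 1) ∘ₗ dI (q + 1)

variable {dI dQ}

lemma modif_isChain (hI : ∀ q e, dI (q + 1) (dI q e) = 0) (hQ : ∀ q e, dQ (q + 1) (dQ q e) = 0)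
    {f : ∀ q, I q →ₗ[R] Q q} (hf : IsChain dI dQ f) (h : ∀ q, I (q + 1) →ₗ[R] Q q) :
    IsChain dI dQ (modif dI dQ f h) := by
  rintro (_ | q) e
  · simp [modif, hI, hf 0 e]
  · simp [modif, hI, hQ, hf (q + 1) e]

/-- Main invariant: there is a chain map inducing `z` times `π` and vanishing on `S` in degrees `≤ r`. -/
def Good {M : Type} [AddCommGroup M] [Module R M] (dI : ∀ q, I q →ₗ[R] I (q + 1))
    (dQ : ∀ q, Q q →ₗ[R] Q (q + 1)) (i : M →ₗ[R] I 0) (p : M →ₗ[R] Q 0)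
    (S : ∀ q, Submodule R (I q)) (r : ℕ) (z : R) : Prop :=
  ∃ f : ∀ q, I q →ₗ[R] Q q, IsChain dI dQ f ∧ (∀ m, f 0 (i m) = z • p m) ∧
    ∀ q < r, ∀ e ∈ S q, f q e = 0

variable {M : Type} [AddCommGroup M] [Module R M] {i : M →ₗ[R] I 0} {p : M →ₗ[R] Q 0}

lemma good_stepA (hI : ∀ q e, dI (q + 1) (dI q e) = 0) (hQ : ∀ q e, dQ (q + 1) (dQ q e) = 0)
    (hi : ∀ m, dI 0 (i m) = 0) (hinj : ∀ q, Module.Injective R (Q q))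
    {J : ∀ q, Submodule R (I q)} (x : ℕ → R)
    (k0 : ∀ e ∈ J 0, dI 0 e = 0 → x 0 • e = 0)
    (kS : ∀ q, ∀ e ∈ J (q + 1), dI (q + 1) e = 0 → ∃ w ∈ J q, dI q w = x (q + 1) • e)
    (r : ℕ) (z : R) (hG : Good dI dQ i p J r z) : Good dI dQ i p J (r + 1) (x r * z) := by
  obtain ⟨f, hf, hf0, hfJ⟩ := hG
  obtain ⟨h, hh⟩ := extend_of_ker_le (hinj r) (dI r ∘ₗ (J r).subtype)
    ((x r • f r) ∘ₗ (J r).subtype) (by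
      rintro ⟨e, he⟩ hde
      replace hde : dI r e = 0 := hde
      change x r • f r e = 0
      rw [← map_smul]
      cases r with
      | zero => rw [k0 e he hde, map_zero]
      | succ r =>
        obtain ⟨w, hw, hw'⟩ := kS r e he hde
        rw [← hw', hf, hfJ r (by omega) w hw, map_zero])
  have hh' : ∀ e ∈ J r, h (dI r e) = x r • f r e := fun e he => hh ⟨e, he⟩
  let H : ∀ q, I (q + 1) →ₗ[R] Q q := fun q => if hq : r = q then hq ▸ h else 0
  have Hr : H r = h := by simp [H]
  have Hne : ∀ q, r ≠ q → H q = 0 := fun q hq => by simp [H, hq]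
  refine ⟨modif dI dQ (fun q => x r • f q) H, modif_isChain hI hQ ?_ H, ?_, ?_⟩
  · intro q e
    simp [hf q e]
  · intro m
    simp [modif, hi, hf0, mul_smul]
  · intro q hq e he
    rcases Nat.lt_succ_iff_lt_or_eq.1 hq with hlt | rfl
    · cases q with
      | zero => simp [modif, Hne 0 (by omega), hfJ 0 hlt e he]
      | succ q => simp [modif, Hne q (by omega), Hne (q+1) (by omega), hfJ _ hlt e he]
    · cases q with
      | zero => simp [modif, Hr, hh' e he]
      | succ q => simp [modif, Hr, Hne q (by omega), hh' e he]

lemma good_stepB (hI : ∀ q e, dI (q + 1) (dI q e) = 0) (hQ : ∀ q e, dQ (q + 1) (dQ q e) = 0)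
    (hi : ∀ m, dI 0 (i m) = 0) (hinj : ∀ q, Module.Injective R (Q q))
    {S S' : ∀ q, Submodule R (I q)} (Y : R)
    (hSd : ∀ q, ∀ e ∈ S q, dI q e ∈ S (q + 1))
    (hSd' : ∀ q, ∀ e ∈ S' q, dI q e ∈ S' (q + 1))
    (hdiv : ∀ q, ∀ e ∈ S' q, ∃ e' ∈ S' q, ∃ j ∈ S q, e = Y • e' + j)
    (htor : ∀ q, ∀ e ∈ S' q, Y • e ∈ S q → e ∈ S q)
    (u : ∀ q, Q (q + 1) →ₗ[R] Q q)
    (u0 : ∀ e, u 0 (dQ 0 e) = Y • e)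
    (uS : ∀ q e, dQ q (u q e) + u (q + 1) (dQ (q + 1) e) = Y • e)
    (r : ℕ) (z : R) (hG : Good dI dQ i p S (r + 1) z) : Good dI dQ i p S' r z := by
  obtain ⟨f, hf, hf0, hfS⟩ := hG
  have key : ∀ q, ∃ h : I (q + 1) →ₗ[R] Q q, q + 1 < r + 1 → ∀ e ∈ S' (q + 1), ∀ j ∈ S (q + 1),
      h (Y • e + j) = u q (f (q + 1) e) := by
    intro q
    by_cases hq : q + 1 < r + 1
    · obtain ⟨h, hh⟩ := extend_of_ker_le (hinj q)
        ((Y • (S' (q + 1)).subtype).coprod (S (q + 1)).subtype)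
        (((u q ∘ₗ f (q + 1)) ∘ₗ (S' (q + 1)).subtype).coprod (0 : S (q + 1) →ₗ[R] Q q)) (by
          rintro ⟨⟨e, he⟩, ⟨j, hj⟩⟩ h0
          replace h0 : Y • e + j = 0 := by simpa using h0
          have : e ∈ S (q + 1) := htor _ e he (by
            rw [eq_neg_of_add_eq_zero_left h0]; exact neg_mem hj)
          simp [hfS _ hq e this])
      exact ⟨h, fun _ e he j hj => by simpa using hh (⟨e, he⟩, ⟨j, hj⟩)⟩
    · exact ⟨0, fun h => absurd h hq⟩
  choose H hH using key
  refine ⟨modif dI dQ f H, modif_isChain hI hQ hf H, fun m => by simp [modif, hi, hf0], ?_⟩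
  intro q hq e he
  obtain ⟨e', he', j, hj, rfl⟩ := hdiv q e he
  have h1 : H q (dI q (Y • e' + j)) = u q (dQ q (f q e')) := by
    rw [map_add, map_smul, hH q (by omega) _ (hSd' q _ he') _ (hSd q _ hj), hf]
  have h2 : f q (Y • e' + j) = Y • f q e' := by
    rw [map_add, map_smul, hfS q (by omega) j hj, add_zero]
  cases q with
  | zero =>
    change f 0 _ - H 0 (dI 0 _) = 0
    rw [h1, h2, u0, sub_self]
  | succ q =>
    change f (q + 1) _ - dQ q (H q _) - H (q + 1) (dI (q + 1) _) = 0
    rw [h1, h2, hH q (by omega) e' he' j hj, ← uS]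
    abel

/-- The algebraic heart. -/
lemma main_alg [IsNoetherianRing R]
    (hI : ∀ q e, dI (q + 1) (dI q e) = 0) (hQ : ∀ q e, dQ (q + 1) (dQ q e) = 0)
    (hi : ∀ m, dI 0 (i m) = 0) (hinjI : ∀ q, Module.Injective R (I q))
    (hinj : ∀ q, Module.Injective R (Q q)) (s : Finset R) (x : ℕ → R)
    (k0 : ∀ e ∈ tors s (I 0), dI 0 e = 0 → x 0 • e = 0)
    (kS : ∀ q, ∀ e ∈ tors s (I (q + 1)), dI (q + 1) e = 0 →
      ∃ w ∈ tors s (I q), dI q w = x (q + 1) • e)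
    (n : ℕ)
    (hu : ∀ y ∈ s, ∃ u : ∀ q, Q (q + 1) →ₗ[R] Q q, (∀ e, u 0 (dQ 0 e) = y ^ n • e) ∧
      (∀ q e, dQ q (u q e) + u (q + 1) (dQ (q + 1) e) = y ^ n • e))
    (f : ∀ q, I q →ₗ[R] Q q) (hf : IsChain dI dQ f) (hf0 : ∀ m, f 0 (i m) = p m)
    (N : ℕ) (hN : s.card < N) (m : M) :
    (∏ q ∈ Finset.range N, x q) • p m = 0 := by
  have h1 : ∀ r, Good dI dQ i p (fun q => tors s (I q)) r (∏ q ∈ Finset.range r, x q) := by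
    intro r
    induction r with
    | zero => exact ⟨f, hf, by simpa using hf0, by simp⟩
    | succ r ih =>
      rw [Finset.prod_range_succ, mul_comm]
      exact good_stepA hI hQ hi hinj x k0 kS r _ ih
  have h2 : ∀ (t : Finset R), t ⊆ s → ∀ r z, Good dI dQ i p (fun q => tors t (I q)) (r + t.card) z →
      Good dI dQ i p (fun q => tors ∅ (I q)) r z := by
    classical
    intro t
    induction t using Finset.induction_on with
    | empty => intro _ r z h; exact h
    | insert y t hy ih =>
      intro hs r z h
      rw [Finset.card_insert_of_notMem hy, ← add_assoc] at h
      apply ih (fun a ha => hs (Finset.mem_insert_of_mem ha))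
      obtain ⟨u, u0, uS⟩ := hu y (hs (Finset.mem_insert_self _ _))
      refine good_stepB hI hQ hi hinj (y ^ n) (fun q e => map_tors _) (fun q e => map_tors _)
        ?_ ?_ u u0 uS _ z h
      · intro q e he
        obtain ⟨e', h1, k, hk⟩ := divis (hinjI q) (y ^ n) e
        have he' : e' ∈ tors t (I q) := fun b hb => by
          obtain ⟨l, hl⟩ := he b hb
          exact ⟨l, h1 _ hl⟩
        refine ⟨e', he', e - y ^ n • e', ?_, by abel⟩
        intro b hb
        rcases Finset.mem_insert.1 hb with rfl | hb
        · exact ⟨n * k, by rw [pow_mul]; exact hk⟩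
        · exact (sub_mem he ((tors t (I q)).smul_mem _ he')) b hb
      · intro q e he hye b hb
        rcases Finset.mem_insert.1 hb with rfl | hb
        · obtain ⟨k, hk⟩ := hye b (Finset.mem_insert_self _ _)
          exact ⟨k + n, by rw [pow_add, mul_smul]; exact hk⟩
        · exact he b hb
  obtain ⟨g, _, hg, hg0⟩ := h2 s subset_rfl (N - s.card) _ (by
    rw [Nat.sub_add_cancel hN.le]; exact h1 N)
  rw [← hg]
  exact hg0 0 (by omega) _ (by simp [mem_tors])

end cplx
end AnnLC


namespace AnnLC
variable {R : Type} [CommRing R]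
open Opposite

/-- map induced on Hom complexes -/
noncomputable def yonMap {X X' : ModuleCat.{0} R} (P : ProjectiveResolution X) (P' : ProjectiveResolution X')
    (ψ : P'.complex ⟶ P.complex) (Y : ModuleCat.{0} R) :
    P.complex.linearYonedaObj R Y ⟶ P'.complex.linearYonedaObj R Y :=
  (HomologicalComplex.unopFunctor (ModuleCat.{0} R) (ComplexShape.down ℕ)).map
    ((((linearYoneda R (ModuleCat.{0} R)).obj Y).rightOp.mapHomologicalComplex _).map ψ).op

lemma yonMap_f {X X' : ModuleCat.{0} R} (P : ProjectiveResolution X) (P' : ProjectiveResolution X')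
    (ψ : P'.complex ⟶ P.complex) (Y : ModuleCat.{0} R) (q : ℕ) (φ : P.complex.X q ⟶ Y) :
    ((yonMap P P' ψ Y).f q).hom φ = ψ.f q ≫ φ := rfl

lemma op_aux {C : Type*} [Category C] {D H D' H' : Cᵒᵖ} {K K' : C} (L : D ≅ H) (L' : D' ≅ H')
    (m : H' ⟶ H) (o : H ⟶ op K) (o' : H' ⟶ op K') (n : K ⟶ K') (h : m ≫ o = o' ≫ n.op) :
    (o.unop ≫ L.hom.unop) ≫ (L'.hom ≫ m ≫ L.inv).unop = n ≫ o'.unop ≫ L'.hom.unop := by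
  apply Quiver.Hom.op_inj
  simp only [op_comp, Quiver.Hom.op_unop, Category.assoc, Iso.inv_hom_id_assoc]
  rw [h]

lemma isoExt_nat {X X' Y : ModuleCat.{0} R} (P : ProjectiveResolution X) (P' : ProjectiveResolution X')
    (g : X' ⟶ X) (ψ : P'.complex ⟶ P.complex)
    (w : ψ ≫ P.π = P'.π ≫ (ChainComplex.single₀ _).map g) (q : ℕ) :
    (P.isoExt (R := R) q Y).inv ≫ ((Ext R (ModuleCat.{0} R) q).map g.op).app Y =
      HomologicalComplex.homologyMap (yonMap P P' ψ Y) q ≫ (P'.isoExt (R := R) q Y).inv := by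
  have h := Functor.leftDerived_map_eq ((linearYoneda R (ModuleCat.{0} R)).obj Y).rightOp q g ψ w
  have h2 : ((Ext R (ModuleCat.{0} R) q).map g.op).app Y =
    ((((linearYoneda R (ModuleCat.{0} R)).obj Y).rightOp.leftDerived q).map g).unop := rfl
  rw [h2, h]
  have h3 := HomologicalComplex.homologyOp_hom_naturality (yonMap P P' ψ Y) q
  have e : ∀ {X : ModuleCat.{0} R} (P : ProjectiveResolution X), (P.isoExt (R := R) q Y).inv =
      ((P.complex.linearYonedaObj R Y).homologyOp q).hom.unop ≫
        (P.isoLeftDerivedObj ((linearYoneda R (ModuleCat.{0} R)).obj Y).rightOp q).hom.unop :=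
    fun P => rfl
  rw [e P, e P']
  exact op_aux (P.isoLeftDerivedObj ((linearYoneda R (ModuleCat.{0} R)).obj Y).rightOp q)
    (P'.isoLeftDerivedObj ((linearYoneda R (ModuleCat.{0} R)).obj Y).rightOp q) _ _ _ _ h3

/-- the class of a cocycle -/
lemma exists_cycle {K : CochainComplex (ModuleCat.{0} R) ℕ} {q : ℕ} (φ : K.X q)
    (h : (K.d q (q + 1)).hom φ = 0) : ∃ c : K.cycles q, (K.iCycles q).hom c = φ := by
  have hn : (ComplexShape.up ℕ).next q = q + 1 := by simp
  have hex : (ShortComplex.mk (K.iCycles q) (K.d q (q + 1)) (K.iCycles_d _ _)).Exact :=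
    ShortComplex.exact_of_f_is_kernel _ (K.cyclesIsKernel q (q + 1) hn)
  exact (ShortComplex.moduleCat_exact_iff _).1 hex φ h

lemma cycle_exact {K : CochainComplex (ModuleCat.{0} R) ℕ} {q q' : ℕ} (hq : (ComplexShape.up ℕ).prev q = q') (c : K.cycles q)
    (h : (K.homologyπ q).hom c = 0) : ∃ b : K.X q', (K.d q' q).hom b = (K.iCycles q).hom c := by
  have hex : (ShortComplex.mk (K.toCycles q' q) (K.homologyπ q) (K.toCycles_comp_homologyπ _ _)).Exact :=
    ShortComplex.exact_of_g_is_cokernel _ (K.homologyIsCokernel q' q hq)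
  obtain ⟨b, hb⟩ := (ShortComplex.moduleCat_exact_iff _).1 hex c h
  refine ⟨b, ?_⟩
  rw [← K.toCycles_i q' q, ← hb]
  rfl

lemma pExtMk_eq_zero {X Y : ModuleCat.{0} R} (P : ProjectiveResolution X) (q : ℕ)
    (φ : P.complex.X q ⟶ Y) (hφ : P.complex.d (q + 1) q ≫ φ = 0)
    (c : (P.complex.linearYonedaObj R Y).cycles q)
    (hc : ((P.complex.linearYonedaObj R Y).iCycles q).hom c = φ)
    (h0 : ((P.complex.linearYonedaObj R Y).homologyπ q).hom c = 0) :
    P.extMk φ (q + 1) rfl hφ = 0 := by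
  cases q with
  | zero =>
    obtain ⟨b, hb⟩ := cycle_exact (q' := 0) (by simp) c h0
    rw [HomologicalComplex.shape _ _ _ (by simp)] at hb
    have : φ = 0 := hc.symm.trans hb.symm
    subst this
    simp
  | succ q =>
    obtain ⟨b, hb⟩ := cycle_exact (q' := q) (by simp) c h0
    rw [P.extMk_eq_zero_iff φ _ rfl hφ q rfl]
    exact ⟨b, hb.trans hc⟩

lemma iExtMk_eq_zero {X Y : ModuleCat.{0} R} (I : InjectiveResolution Y)
    (φ : X ⟶ I.cocomplex.X 0) (hφ : φ ≫ I.cocomplex.d 0 1 = 0)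
    (h : I.extMk φ 1 rfl hφ = 0) : φ = 0 := by
  rw [← I.extEquivCohomologyClass.apply_eq_iff_eq,
    InjectiveResolution.extEquivCohomologyClass_extMk, 
    InjectiveResolution.extEquivCohomologyClass_zero,
    CochainComplex.HomComplex.CohomologyClass.mk_eq_zero_iff,
    CochainComplex.HomComplex.Cocycle.fromSingleMk_mem_coboundaries_iff _ _ _ _ _ (-1) (by simp)] at h
  obtain ⟨g, hg⟩ := h
  have : g = 0 := by
    refine Limits.IsZero.eq_of_tgt ?_ _ _
    exact I.cochainComplex.isZero_of_isStrictlyGE 0 (-1) (by simp)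
  rw [this, Limits.zero_comp] at hg
  refine (cancel_mono (I.cochainComplexXIso 0 0 rfl).inv).1 ?_
  rw [Limits.zero_comp]
  exact hg.symm

/-- Key comparison on one level. -/
lemma compare {X Y : ModuleCat.{0} R} (I : InjectiveResolution Y) (q : ℕ) (x : R)
    (z : X ⟶ I.cocomplex.X q) (hz : z ≫ I.cocomplex.d q (q + 1) = 0) :
    ∃ e : ((Ext R (ModuleCat.{0} R) q).obj (op X)).obj Y, ∀ (X' : ModuleCat.{0} R) (g : X' ⟶ X),
      (((Ext R (ModuleCat.{0} R) q).map g.op).app Y).hom (x • e) = 0 → 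
      I.extMk (x • (g ≫ z)) (q + 1) rfl (by simp [hz]) = 0 := by
  let P := ProjectiveResolution.of X
  obtain ⟨φ, hφ, hPI⟩ := P.extMk_surjective (I.extMk z (q + 1) rfl hz) (q + 1) rfl
  obtain ⟨c, hc⟩ := exists_cycle (K := P.complex.linearYonedaObj R Y) (q := q) φ hφ
  refine ⟨(P.isoExt (R := R) q Y).inv.hom (((P.complex.linearYonedaObj R Y).homologyπ q).hom c), ?_⟩
  intro X' g h0
  let P' := ProjectiveResolution.of X'
  let ψ := ProjectiveResolution.lift g P' P
  have hw : ψ ≫ P.π = P'.π ≫ (ChainComplex.single₀ _).map g := ProjectiveResolution.lift_commutes _ _ _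
  have hnat := isoExt_nat (Y := Y) P P' g ψ hw q
  let c' := (HomologicalComplex.cyclesMap (yonMap P P' ψ Y) q).hom (x • c)
  have hc' : ((P'.complex.linearYonedaObj R Y).iCycles q).hom c' = x • (ψ.f q ≫ φ) := by
    have := ConcreteCategory.congr_hom (HomologicalComplex.cyclesMap_i (yonMap P P' ψ Y) q) (x • c)
    refine this.trans ?_
    change ((yonMap P P' ψ Y).f q).hom (((P.complex.linearYonedaObj R Y).iCycles q).hom (x • c)) = _
    refine (congrArg ((yonMap P P' ψ Y).f q).hom (map_smul _ x c)).trans ((map_smul _ x _).trans ?_)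
    rw [hc]
    rfl
  have h0' : ((P'.complex.linearYonedaObj R Y).homologyπ q).hom c' = 0 := by
    have h1 := ConcreteCategory.congr_hom (HomologicalComplex.homologyπ_naturality (yonMap P P' ψ Y) q) (x • c)
    have h2 := ConcreteCategory.congr_hom hnat (((P.complex.linearYonedaObj R Y).homologyπ q).hom (x • c))
    rw [← map_smul, ← map_smul] at h0
    have h3 := h2.symm.trans h0
    have hinj : Function.Injective (P'.isoExt (R := R) q Y).inv.hom :=
      (ModuleCat.mono_iff_injective _).1 inferInstance
    have h4 : (HomologicalComplex.homologyMap (yonMap P P' ψ Y) q).hom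
      (((P.complex.linearYonedaObj R Y).homologyπ q).hom (x • c)) = 0 :=
      hinj (h3.trans (map_zero _).symm)
    exact h1.symm.trans h4
  have hcoc : P'.complex.d (q + 1) q ≫ (x • (ψ.f q ≫ φ)) = 0 := by
    simp [← ψ.comm_assoc, hφ]
  have hP0 := pExtMk_eq_zero P' q (x • (ψ.f q ≫ φ)) hcoc c' hc' h0'
  have hP1 := ProjectiveResolution.mk₀_comp_extMk (R := P) (R' := P') φ (q + 1) rfl hφ (g := x • g)
    ⟨x • ψ, by
      have := ProjectiveResolution.lift_commutes_zero g P' P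
      ext m
      have h5 := congrArg (fun t => x • t) (ConcreteCategory.congr_hom this m)
      refine (map_smul (P.π.f 0).hom x _).trans (h5.trans ?_)
      rfl⟩
  have hI1 := I.mk₀_comp_extMk z (q + 1) rfl hz (x • g)
  rw [hPI, hI1] at hP1
  simp only [Linear.smul_comp, HomologicalComplex.smul_f_apply] at hP1
  rw [hP1]
  exact hP0
end AnnLC

namespace AnnLC
open Opposite
variable {R : Type} [CommRing R]

lemma colim_kill (a : Ideal R) (M : ModuleCat.{0} R) (q : ℕ) (x : R)
    (hx : x ∈ Module.annihilator R ((localCohomology a q).obj M)) (n : ℕ)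
    (e : ((Ext R (ModuleCat.{0} R) q).obj (op (ModuleCat.of R (R ⧸ a ^ n)))).obj M) :
    ∃ (n' : ℕ) (hn : n ≤ n'),
      (((Ext R (ModuleCat.{0} R) q).map
        (ModuleCat.ofHom (Submodule.mapQ (a ^ n') (a ^ n) LinearMap.id
          (Ideal.pow_le_pow_right hn))).op).app M).hom (x • e) = 0 := by
  have hc := Limits.isColimitOfPreserves ((evaluation (ModuleCat.{0} R) (ModuleCat.{0} R)).obj M)
    (Limits.colimit.isColimit (localCohomology.diagram (localCohomology.idealPowersDiagram a) q))
  let F := localCohomology.diagram (localCohomology.idealPowersDiagram a) q ⋙ ((evaluation (ModuleCat.{0} R) (ModuleCat.{0} R)).obj M)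
  let D := ((evaluation (ModuleCat.{0} R) (ModuleCat.{0} R)).obj M).mapCocone (Limits.colimit.cocone (localCohomology.diagram (localCohomology.idealPowersDiagram a) q))
  have h0 : (D.ι.app (op (op n))).hom (x • e) = 0 := 
    (map_smul (D.ι.app (op (op n))).hom x e).trans (Module.mem_annihilator.1 hx _)
  obtain ⟨k, f, g, hfg⟩ := Limits.Concrete.isColimit_exists_of_rep_eq F (D := D) (i := op (op n)) (j := op (op n)) hc (x • e) (0 : F.obj (op (op n))) (h0.trans (map_zero (D.ι.app (op (op n))).hom).symm)
  refine ⟨k.unop.unop, f.unop.unop.down.down, ?_⟩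
  exact hfg.trans (map_zero (F.map g).hom)

lemma compare_elt (a : Ideal R) (M : ModuleCat.{0} R) (I : InjectiveResolution M) (q : ℕ) (x : R)
    (hx : x ∈ Module.annihilator R ((localCohomology a q).obj M)) (n : ℕ)
    (e : I.cocomplex.X q) (hd : (I.cocomplex.d q (q + 1)).hom e = 0)
    (hn : ∀ r ∈ a ^ n, r • e = 0) :
    ∃ (n' : ℕ) (z : ModuleCat.of R (R ⧸ a ^ n') ⟶ I.cocomplex.X q)
      (hz : z ≫ I.cocomplex.d q (q + 1) = 0),
      z.hom (Submodule.Quotient.mk 1) = x • e ∧ I.extMk z (q + 1) rfl hz = 0 := by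
  let z : ModuleCat.of R (R ⧸ a ^ n) ⟶ I.cocomplex.X q :=
    ModuleCat.ofHom ((a ^ n).liftQ (LinearMap.toSpanSingleton R _ e) (fun r hr => hn r hr))
  have hz : z ≫ I.cocomplex.d q (q + 1) = 0 := by
    refine ModuleCat.hom_ext (LinearMap.ext fun t => ?_)
    obtain ⟨r, rfl⟩ := Submodule.Quotient.mk_surjective _ t
    exact (map_smul (I.cocomplex.d q (q + 1)).hom r e).trans (by rw [hd]; exact smul_zero r)
  obtain ⟨e', he'⟩ := compare I q x z hz
  obtain ⟨n', hnn, h0⟩ := colim_kill a M q x hx n e'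
  refine ⟨n', _, _, ?_, he' _ _ h0⟩
  change x • ((1 : R) • e) = x • e
  rw [one_smul]

lemma k_zero [IsNoetherianRing R] (a : Ideal R) (M : ModuleCat.{0} R) (I : InjectiveResolution M) (x : R)
    (hx : x ∈ Module.annihilator R ((localCohomology a 0).obj M)) (s : Finset R)
    (hs : Ideal.span (s : Set R) = a)
    (e : I.cocomplex.X 0) (he : e ∈ tors s (I.cocomplex.X 0))
    (hd : (I.cocomplex.d 0 1).hom e = 0) : x • e = 0 := by
  obtain ⟨n, hn⟩ := (mem_tors_iff_pow).1 he
  rw [hs] at hn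
  obtain ⟨n', z, hz, h1, h2⟩ := compare_elt a M I 0 x hx n e hd hn
  rw [← h1, iExtMk_eq_zero I z hz h2]
  rfl

lemma k_succ [IsNoetherianRing R] (a : Ideal R) (M : ModuleCat.{0} R) (I : InjectiveResolution M) (q : ℕ) (x : R)
    (hx : x ∈ Module.annihilator R ((localCohomology a (q + 1)).obj M)) (s : Finset R)
    (hs : Ideal.span (s : Set R) = a)
    (e : I.cocomplex.X (q + 1)) (he : e ∈ tors s (I.cocomplex.X (q + 1)))
    (hd : (I.cocomplex.d (q + 1) (q + 1 + 1)).hom e = 0) :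
    ∃ w ∈ tors s (I.cocomplex.X q), (I.cocomplex.d q (q + 1)).hom w = x • e := by
  obtain ⟨n, hn⟩ := (mem_tors_iff_pow).1 he
  rw [hs] at hn
  obtain ⟨n', z, hz, h1, h2⟩ := compare_elt a M I (q + 1) x hx n e hd hn
  obtain ⟨w, hw⟩ := (I.extMk_eq_zero_iff z _ rfl hz q rfl).1 h2
  refine ⟨w.hom (Submodule.Quotient.mk 1), ?_, ?_⟩
  · rw [mem_tors_iff_pow, hs]
    refine ⟨n', fun r hr => ?_⟩
    rw [← map_smul]
    have : r • (Submodule.Quotient.mk 1 : R ⧸ a ^ n') = 0 := by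
      rw [← Submodule.Quotient.mk_smul, Submodule.Quotient.mk_eq_zero]
      simpa using hr
    exact (congrArg w.hom this).trans (map_zero _)
  · rw [← h1, ← hw]
    rfl

lemma homotopy_exists (T : ModuleCat.{0} R) (Q : InjectiveResolution T) (r : R)
    (hr : ∀ t : T, r • t = 0) :
    ∃ u : ∀ q, Q.cocomplex.X (q + 1) →ₗ[R] Q.cocomplex.X q,
      (∀ e, u 0 ((Q.cocomplex.d 0 1).hom e) = r • e) ∧
      (∀ q e, (Q.cocomplex.d q (q + 1)).hom (u q e) +
        u (q + 1) ((Q.cocomplex.d (q + 1) (q + 1 + 1)).hom e) = r • e) := by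
  let φ : Q.cocomplex ⟶ Q.cocomplex := r • 𝟙 _
  have comm : Q.ι ≫ φ = 0 := by
    ext t
    have : (φ.f 0).hom ((Q.ι.f 0).hom t) = r • ((Q.ι.f 0).hom t) := rfl
    refine this.trans ?_
    rw [← map_smul]
    exact (congrArg _ (hr t)).trans (map_zero _)
  let h := InjectiveResolution.descHomotopyZero φ comm
  refine ⟨fun q => (h.hom (q + 1) q).hom, fun e => ?_, fun q e => ?_⟩
  · have := h.comm 0
    rw [Homotopy.dNext_cochainComplex, Homotopy.prevD_zero_cochainComplex] at this
    have h2 := ConcreteCategory.congr_hom this e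
    simp at h2
    exact h2.symm
  · have := h.comm (q + 1)
    rw [Homotopy.dNext_cochainComplex, Homotopy.prevD_succ_cochainComplex] at this
    have h2 := ConcreteCategory.congr_hom this e
    simp at h2
    exact (add_comm _ _).trans h2.symm

lemma leftDerived_isZero {D : Type*} [Category D] [Abelian D] (F : ModuleCat.{0} R ⥤ D) [F.Additive]
    (q : ℕ) {X : ModuleCat.{0} R} (hX : Limits.IsZero X) :
    Limits.IsZero ((F.leftDerived q).obj X) := by
  let P := ProjectiveResolution.of X
  have h := Functor.leftDerived_map_eq F q (0 : X ⟶ X) (P := P) (Q := P) 0 (by simp)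
  rw [Limits.IsZero.iff_id_eq_zero, ← CategoryTheory.Functor.map_id, hX.eq_of_src (𝟙 X) 0, h]
  simp
  exact Limits.zero_comp

lemma subsing_top (M : ModuleCat.{0} R) (q : ℕ) :
    Subsingleton ((localCohomology (⊤ : Ideal R) q).obj M) := by
  have hc := Limits.isColimitOfPreserves ((evaluation (ModuleCat.{0} R) (ModuleCat.{0} R)).obj M)
    (Limits.colimit.isColimit
      (localCohomology.diagram (localCohomology.idealPowersDiagram (⊤ : Ideal R)) q))
  have key : ∀ y : (localCohomology (⊤ : Ideal R) q).obj M, y = 0 := by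
    intro y
    obtain ⟨k, e, he⟩ := Limits.Concrete.isColimit_exists_rep _ hc y
    have hX : Limits.IsZero (ModuleCat.of R (R ⧸ (⊤ : Ideal R) ^ k.unop.unop)) := by
      have : Subsingleton (R ⧸ (⊤ : Ideal R) ^ k.unop.unop) := by
        rw [Ideal.top_pow]
        exact Ideal.Quotient.subsingleton_iff.2 rfl
      exact ModuleCat.isZero_of_subsingleton _
    have hZ : Limits.IsZero (((Ext R (ModuleCat.{0} R) q).obj
        (op (ModuleCat.of R (R ⧸ (⊤ : Ideal R) ^ k.unop.unop)))).obj M) :=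
      (leftDerived_isZero ((linearYoneda R (ModuleCat.{0} R)).obj M).rightOp q hX).unop
    have he0 : e = 0 := (ModuleCat.subsingleton_of_isZero hZ).elim _ _
    rw [← he, he0]
    exact map_zero (((evaluation (ModuleCat.{0} R) (ModuleCat.{0} R)).obj M).mapCocone
      (Limits.colimit.cocone _) |>.ι.app k).hom
  exact ⟨fun y y' => (key y).trans (key y').symm⟩

lemma kill_mod [IsNoetherianRing R] (a : Ideal R) (M : ModuleCat.{0} R) (x : ℕ → R)
    (hx : ∀ q, x q ∈ Module.annihilator R ((localCohomology a q).obj M)) (s : Finset R)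
    (hs : Ideal.span (s : Set R) = a) (N : ℕ) (hN : s.card < N) (n : ℕ) (m : M) :
    (∏ q ∈ Finset.range N, x q) • m ∈ (a ^ n • ⊤ : Submodule R M) := by
  let T : ModuleCat.{0} R := ModuleCat.of R (M ⧸ (a ^ n • ⊤ : Submodule R M))
  let π : M ⟶ T := ModuleCat.ofHom (Submodule.mkQ _)
  let I := InjectiveResolution.of M
  let Q := InjectiveResolution.of T
  let F := InjectiveResolution.desc π Q I
  have hT : ∀ y ∈ s, ∀ t : T, y ^ n • t = 0 := by
    intro y hy t
    obtain ⟨m, rfl⟩ := Submodule.Quotient.mk_surjective _ t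
    refine (Submodule.Quotient.mk_eq_zero _).2 ?_
    refine Submodule.smul_mem_smul (Ideal.pow_mem_pow ?_ n) trivial
    rw [← hs]
    exact Ideal.subset_span hy
  have hmain := main_alg (R := R) (I := fun q => I.cocomplex.X q) (Q := fun q => Q.cocomplex.X q)
    (dI := fun q => (I.cocomplex.d q (q + 1)).hom) (dQ := fun q => (Q.cocomplex.d q (q + 1)).hom)
    (M := M) (i := (I.ι.f 0).hom) (p := (π ≫ Q.ι.f 0).hom)
    (fun q e => ConcreteCategory.congr_hom (I.cocomplex.d_comp_d q (q + 1) (q + 1 + 1)) e)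
    (fun q e => ConcreteCategory.congr_hom (Q.cocomplex.d_comp_d q (q + 1) (q + 1 + 1)) e)
    (fun m => ConcreteCategory.congr_hom I.ι_f_zero_comp_complex_d m)
    (fun q => Module.injective_module_of_injective_object R (I.cocomplex.X q)
      (inj := I.injective q))
    (fun q => Module.injective_module_of_injective_object R (Q.cocomplex.X q)
      (inj := Q.injective q))
    s x
    (fun e he hd => k_zero a M I (x 0) (hx 0) s hs e he hd)
    (fun q e he hd => k_succ a M I q (x (q + 1)) (hx _) s hs e he hd)
    n (fun y hy => homotopy_exists T Q (y ^ n) (hT y hy))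
    (fun q => (F.f q).hom)
    (fun q e => (ConcreteCategory.congr_hom (F.comm q (q + 1)) e).symm)
    (fun m => ConcreteCategory.congr_hom (InjectiveResolution.desc_commutes_zero π Q I) m)
    N hN m
  have hinj : Function.Injective (Q.ι.f 0).hom :=
    (ModuleCat.mono_iff_injective _).1 inferInstance
  have hmain := (map_smul (π ≫ Q.ι.f 0).hom _ m).trans hmain
  have h2 : π.hom ((∏ q ∈ Finset.range N, x q) • m) = 0 :=
    hinj (hmain.trans (map_zero (Q.ι.f 0).hom).symm)
  exact (Submodule.Quotient.mk_eq_zero _).1 h2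

lemma prod_ideal_le (S : Finset ℕ) (J : ℕ → Ideal R) : ∀ K : Ideal R,
    (∀ x : ℕ → R, (∀ i ∈ S, x i ∈ J i) → ∏ i ∈ S, x i ∈ K) → ∏ i ∈ S, J i ≤ K := by
  classical
  induction S using Finset.induction_on with
  | empty =>
    intro K h
    have := h (fun _ => 1) (by simp)
    rw [Finset.prod_empty] at this
    rw [(Ideal.eq_top_iff_one K).2 this]
    exact le_top
  | insert j S hj ih =>
    intro K h
    rw [Finset.prod_insert hj, Ideal.mul_le]
    intro r hr t ht
    refine ih (Submodule.comap (LinearMap.mulLeft R r) K) ?_ ht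
    intro x hx
    have h1 := h (Function.update x j r) (by
      intro i hi
      rcases Finset.mem_insert.1 hi with rfl | hi
      · simpa using hr
      · rw [Function.update_of_ne (fun e : i = j => hj (e ▸ hi))]
        exact hx i hi)
    rw [Finset.prod_insert hj, Function.update_self,
      Finset.prod_congr rfl (fun i hi => Function.update_of_ne (fun e : i = j => hj (e ▸ hi)) r x)] at h1
    exact h1

end AnnLC

theorem stmt8 {R : Type} [CommRing R] [IsNoetherianRing R] [IsLocalRing R]
    (a : Ideal R) (M : ModuleCat R) [Module.Finite R M] (hM : Nontrivial M)
    (g c : ℕ)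
    (hgrade : Nontrivial ((localCohomology a g).obj M) ∧
      ∀ i, i < g → Subsingleton ((localCohomology a i).obj M))
    (hcd : HasCD a M c) :
    ∏ i ∈ Finset.Icc g c,
        Module.annihilator R ((localCohomology a i).obj M) ≤
      Module.annihilator R M := by
  classical
  have ha : a ≠ ⊤ := by
    rintro rfl
    exact not_subsingleton_iff_nontrivial.2 hgrade.1 (AnnLC.subsing_top M g)
  obtain ⟨s, hs⟩ := (isNoetherianRing_iff_ideal_fg R).1 inferInstance a
  refine AnnLC.prod_ideal_le _ _ _ fun x hx => ?_
  rw [Module.mem_annihilator]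
  intro m
  let x' : ℕ → R := fun q => if q ∈ Finset.Icc g c then x q else 1
  have hx' : ∀ q, x' q ∈ Module.annihilator R ((localCohomology a q).obj M) := by
    intro q
    by_cases hq : q ∈ Finset.Icc g c
    · simpa only [x', if_pos hq] using hx q hq
    · have hsub : Subsingleton ((localCohomology a q).obj M) := by
        rw [Finset.mem_Icc, not_and_or, not_le, not_le] at hq
        rcases hq with hq | hq
        · exact hgrade.2 q hq
        · exact hcd.2 q hq
      exact Module.mem_annihilator.2 fun _ => Subsingleton.elim _ _
  have hprod : ∏ q ∈ Finset.range (s.card + c + 1), x' q = ∏ i ∈ Finset.Icc g c, x i := by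
    rw [← Finset.prod_subset (s₁ := Finset.Icc g c)]
    · exact Finset.prod_congr rfl fun q hq => if_pos hq
    · intro q hq
      rw [Finset.mem_Icc] at hq
      rw [Finset.mem_range]
      omega
    · intro q _ hq
      exact if_neg hq
  have hmem : (∏ i ∈ Finset.Icc g c, x i) • m ∈ (⨅ n : ℕ, a ^ n • ⊤ : Submodule R M) := by
    rw [Submodule.mem_iInf]
    intro n
    rw [← hprod]
    exact AnnLC.kill_mod a M x' hx' s hs _ (by omega) n m
  rw [Ideal.iInf_pow_smul_eq_bot_of_isLocalRing a ha] at hmem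
  exact hmem
end
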